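/- arXiv:math/0411489 — 2 statements merged into one kernel-verified Lean document; each statement's English description precedes it below -/
import Mathlib

section
/- Let U be a set and (f^u)_{u∈U} a family of elements of 𝓛 such that for every finitely supported family (α_u)_{u∈U} of non-negative real numbers the function f^α = (Σ_u α_u²·|f^u|²)^{1/2} satisfies ‖f^α‖_𝓛 ≤ (Σ_u α_u²)^{1/2}. Then there exists g ∈ 𝓜₁⁺ such that for every u ∈ U: f^u(x) = 0 for almost every x with g(x) = 0, and ∫_{{g>0}} |f^u(x)|²/g(x)² dx ≤ 1. -/
open MeasureTheory
open scoped ENNReal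

noncomputable section

/-- The unit cube `K_a = a + (−1/2, 1/2]ⁿ` centered at `a ∈ ℤⁿ`. -/
def cube {n : ℕ} (a : Fin n → ℤ) : Set (Fin n → ℝ) :=
  {x | ∀ i, (a i : ℝ) - 1 / 2 < x i ∧ x i ≤ (a i : ℝ) + 1 / 2}

/-- `‖χ_a f‖_{L^p}` : the `L^p` norm of `f` restricted to the cube `K_a`. -/
def pieceNorm {n : ℕ} {F : Type*} [NormedAddCommGroup F] (p : ℝ)
    (f : (Fin n → ℝ) → F) (a : Fin n → ℤ) : ℝ≥0∞ :=
  eLpNorm ((cube a).indicator f) (ENNReal.ofReal p) volume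

/-- `f` belongs to the space `𝓛 = ℓ²_λ(L^p)`. -/
def MemL {n : ℕ} {F : Type*} [NormedAddCommGroup F] (p : ℝ) (lam : (Fin n → ℤ) → ℝ)
    (f : (Fin n → ℝ) → F) : Prop :=
  AEStronglyMeasurable f volume ∧ (∀ a, pieceNorm p f a < ∞) ∧
    Summable fun a => lam a ^ 2 * (pieceNorm p f a).toReal ^ 2

/-- The square `‖f‖_𝓛²` of the norm of `𝓛 = ℓ²_λ(L^p)`. -/
def LnormSq {n : ℕ} {F : Type*} [NormedAddCommGroup F] (p : ℝ) (lam : (Fin n → ℤ) → ℝ)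
    (f : (Fin n → ℝ) → F) : ℝ :=
  ∑' a, lam a ^ 2 * (pieceNorm p f a).toReal ^ 2

theorem nested_aux {H : Type*} [NormedAddCommGroup H] [InnerProductSpace ℝ H] [CompleteSpace H]
    {ι : Type*} [Nonempty ι] [SemilatticeSup ι] (K : ι → Set H) (hanti : Antitone K)
    (hne : ∀ i, (K i).Nonempty) (hcl : ∀ i, IsClosed (K i)) (hcv : ∀ i, Convex ℝ (K i))
    (R : ℝ) (hR : ∀ i, ∀ x ∈ K i, ‖x‖ ≤ R) : ∃ x, ∀ i, x ∈ K i := by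
  have hm : ∀ i, ∃ v ∈ K i, ∀ w ∈ K i, ‖v‖ ≤ ‖w‖ := by
    intro i
    obtain ⟨v, hv, h⟩ := exists_norm_eq_iInf_of_complete_convex (hne i) (hcl i).isComplete (hcv i) 0
    refine ⟨v, hv, fun w hw => ?_⟩
    have h1 : (⨅ w : K i, ‖(0:H) - w‖) ≤ ‖(0:H) - (⟨w, hw⟩ : K i)‖ :=
      ciInf_le ⟨0, by rintro _ ⟨y, rfl⟩; exact norm_nonneg _⟩ (⟨w, hw⟩ : K i)
    rw [← h] at h1
    simpa using h1
  choose m hmK hmin using hm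
  have hRn : ∀ i, ‖m i‖ ^ 2 ≤ R ^ 2 := fun i => pow_le_pow_left₀ (norm_nonneg _) (hR i _ (hmK i)) 2
  have hbdd : BddAbove (Set.range fun i => ‖m i‖ ^ 2) := ⟨R ^ 2, by rintro _ ⟨i, rfl⟩; exact hRn i⟩
  have key : ∀ i j, i ≤ j → ‖m j - m i‖ ^ 2 ≤ 2 * (‖m j‖ ^ 2 - ‖m i‖ ^ 2) := by
    intro i j hij
    have h1 : (1/2 : ℝ) • m j + (1/2 : ℝ) • m i ∈ K i :=
      hcv i (hanti hij (hmK j)) (hmK i) (by norm_num) (by norm_num) (by norm_num)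
    have h2 := hmin i _ h1
    have h3 := parallelogram_law_with_norm ℝ (m j) (m i)
    rw [← smul_add, norm_smul] at h2
    norm_num at h2
    nlinarith [norm_nonneg (m i), norm_nonneg (m j + m i)]
  have hc : CauchySeq m := by
    rw [Metric.cauchySeq_iff']
    intro ε hε
    obtain ⟨N, hN⟩ := exists_lt_of_lt_ciSup
      (show (⨆ i, ‖m i‖ ^ 2) - ε ^ 2 / 2 < ⨆ i, ‖m i‖ ^ 2 by have := pow_pos hε 2; linarith)
    refine ⟨N, fun j hj => ?_⟩
    have h1 := key N j hj
    have h2 : ‖m j‖ ^ 2 ≤ ⨆ i, ‖m i‖ ^ 2 := le_ciSup hbdd j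
    rw [dist_eq_norm]
    refine lt_of_pow_lt_pow_left₀ 2 hε.le ?_
    linarith
  obtain ⟨x, hx⟩ := cauchySeq_tendsto_of_complete hc
  refine ⟨x, fun i => (hcl i).mem_of_tendsto hx ?_⟩
  filter_upwards [Filter.eventually_ge_atTop i] with j hj
  exact hanti hj (hmK j)

theorem fin_aux {H : Type*} [AddCommGroup H] [Module ℝ H] {ι : Type*} [Fintype ι]
    (C : Set H) (hC : Convex ℝ C) (φ : ι → H → ℝ≥0∞)
    (hφ : ∀ i, ∀ x ∈ C, ∀ y ∈ C, ∀ a b : ℝ, 0 ≤ a → 0 ≤ b → a + b = 1 →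
      φ i (a • x + b • y) ≤ ENNReal.ofReal a * φ i x + ENNReal.ofReal b * φ i y)
    (h : ∀ c : ι → ℝ, (∀ i, 0 < c i) →
      ∃ x ∈ C, ∑ i, ENNReal.ofReal (c i) * φ i x ≤ ENNReal.ofReal (∑ i, c i))
    (ε : ℝ) (hε : 0 < ε) : ∃ x ∈ C, ∀ i, φ i x ≤ ENNReal.ofReal (1 + ε) := by
  classical
  by_contra hcon
  push Not at hcon
  let A : Set (ι → ℝ) := {y | (∀ i, 0 ≤ y i) ∧ ∃ x ∈ C, ∀ i, φ i x ≤ ENNReal.ofReal (y i)}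
  let O : Set (ι → ℝ) := Set.pi Set.univ fun _ => Set.Iio (1 + ε)
  have hA : Convex ℝ A := by
    rintro y ⟨hy, x, hx, hxy⟩ y' ⟨hy', x', hx', hxy'⟩ a b ha hb hab
    refine ⟨fun i => ?_, a • x + b • x', hC hx hx' ha hb hab, fun i => ?_⟩
    · have := mul_nonneg ha (hy i)
      have := mul_nonneg hb (hy' i)
      simp only [Pi.add_apply, Pi.smul_apply, smul_eq_mul]; positivity
    · refine (hφ i x hx x' hx' a b ha hb hab).trans ?_
      simp only [Pi.add_apply, Pi.smul_apply, smul_eq_mul]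
      rw [ENNReal.ofReal_add (mul_nonneg ha (hy i)) (mul_nonneg hb (hy' i)),
        ENNReal.ofReal_mul ha, ENNReal.ofReal_mul hb]
      gcongr
      · exact hxy i
      · exact hxy' i
  have hO : Convex ℝ O := convex_pi fun _ _ => convex_Iio _
  have hO' : IsOpen O := isOpen_set_pi Set.finite_univ fun _ _ => isOpen_Iio
  have hdisj : Disjoint O A := by
    rw [Set.disjoint_left]
    rintro y hyO ⟨hy, x, hx, hxy⟩
    obtain ⟨i, hi⟩ := hcon x hx
    have := (hxy i).trans (ENNReal.ofReal_le_ofReal (le_of_lt (hyO i trivial)))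
    exact absurd this (not_le.2 hi)
  obtain ⟨F, t, hF1, hF2⟩ := geometric_hahn_banach_open hO hO' hA hdisj
  set c : ι → ℝ := fun i => F (Pi.single i 1) with hc
  have hFy : ∀ y : ι → ℝ, F y = ∑ i, y i * c i := by
    intro y
    conv_lhs => rw [pi_eq_sum_univ' y]
    rw [map_sum]
    refine Finset.sum_congr rfl fun i _ => ?_
    rw [map_smul, smul_eq_mul]
  have ht : 0 < t := by
    have := hF1 0 (fun i _ => by simp; linarith)
    simpa using this
  have hc0 : ∀ i, 0 ≤ c i := by
    intro i
    by_contra hneg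
    push Not at hneg
    have h1 := hF1 ((t / c i) • Pi.single i 1) (by
      intro j _
      simp only [Pi.smul_apply, smul_eq_mul, Set.mem_Iio, Pi.single_apply]
      have := div_neg_of_pos_of_neg ht hneg
      split_ifs <;> linarith)
    rw [map_smul, smul_eq_mul] at h1
    change t / c i * c i < t at h1
    rw [div_mul_cancel₀ _ hneg.ne] at h1
    exact lt_irrefl _ h1
  have h2 : (1 + ε / 2) * ∑ i, c i < t := by
    have := hF1 (fun _ => 1 + ε / 2) (fun i _ => by simp; linarith)
    rw [hFy, ← Finset.mul_sum] at this
    exact this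
  have h3 : ∀ δ > 0, t ≤ ∑ i, c i + δ * Fintype.card ι := by
    intro δ hδ
    obtain ⟨x, hx, hle⟩ := h (fun i => c i + δ) (fun i => by have := hc0 i; linarith)
    have hfin : ∀ i, φ i x ≠ ∞ := by
      intro i hi
      have h4 := (Finset.single_le_sum (f := fun i => ENNReal.ofReal (c i + δ) * φ i x)
        (fun _ _ => zero_le) (Finset.mem_univ i)).trans hle
      simp only [hi] at h4
      rw [ENNReal.mul_top (by simp; have := hc0 i; linarith)] at h4
      simp at h4
    have h5 := hF2 (fun i => (φ i x).toReal)
      ⟨fun i => ENNReal.toReal_nonneg, x, hx, fun i => by rw [ENNReal.ofReal_toReal (hfin i)]⟩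
    rw [hFy] at h5
    refine h5.trans ?_
    have h6 : ∑ i, (c i + δ) * (φ i x).toReal ≤ ∑ i, (c i + δ) := by
      have hp : ∀ i, 0 ≤ c i + δ := fun i => by have := hc0 i; linarith
      rw [← ENNReal.ofReal_le_ofReal_iff (Finset.sum_nonneg fun i _ => hp i),
        ENNReal.ofReal_sum_of_nonneg (fun i _ => mul_nonneg (hp i) ENNReal.toReal_nonneg)]
      refine le_trans (le_of_eq ?_) hle
      refine Finset.sum_congr rfl fun i _ => ?_
      rw [ENNReal.ofReal_mul (hp i), ENNReal.ofReal_toReal (hfin i)]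
    calc ∑ i, (φ i x).toReal * c i ≤ ∑ i, (c i + δ) * (φ i x).toReal := by
          refine Finset.sum_le_sum fun i _ => ?_
          have : 0 ≤ (φ i x).toReal := ENNReal.toReal_nonneg
          nlinarith
      _ ≤ _ := h6
      _ = _ := by rw [Finset.sum_add_distrib]; simp [mul_comm]
  have h4 : t ≤ ∑ i, c i := by
    refine le_of_forall_pos_le_add fun δ hδ => ?_
    have hN : (0:ℝ) ≤ Fintype.card ι := by positivity
    have := h3 (δ / (Fintype.card ι + 1)) (by positivity)
    refine this.trans ?_
    gcongr
    rw [div_mul_eq_mul_div, div_le_iff₀ (by positivity)]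
    nlinarith
  have h5 : 0 ≤ ∑ i, c i := Finset.sum_nonneg fun i _ => hc0 i
  nlinarith

theorem minimax_aux {H : Type*} [NormedAddCommGroup H] [InnerProductSpace ℝ H] [CompleteSpace H]
    {U : Type*} (C : Set H) (hC : Convex ℝ C) (hCc : IsClosed C) (R : ℝ) (hR : ∀ x ∈ C, ‖x‖ ≤ R)
    (φ : U → H → ℝ≥0∞)
    (hφ : ∀ i, ∀ x ∈ C, ∀ y ∈ C, ∀ a b : ℝ, 0 ≤ a → 0 ≤ b → a + b = 1 →
      φ i (a • x + b • y) ≤ ENNReal.ofReal a * φ i x + ENNReal.ofReal b * φ i y)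
    (hl : ∀ i, ∀ r : ℝ≥0∞, IsClosed {x | φ i x ≤ r})
    (h : ∀ (s : Finset U) (c : U → ℝ), (∀ i, 0 < c i) →
      ∃ x ∈ C, ∑ i ∈ s, ENNReal.ofReal (c i) * φ i x ≤ ENNReal.ofReal (∑ i ∈ s, c i)) :
    ∃ x ∈ C, ∀ i, φ i x ≤ 1 := by
  classical
  let K : Finset U × ℕ → Set H := fun j =>
    C ∩ ⋂ i ∈ j.1, {x | φ i x ≤ ENNReal.ofReal (1 + 1 / ((j.2 : ℝ) + 1))}
  have hK : ∀ j x, x ∈ K j ↔ x ∈ C ∧ ∀ i ∈ j.1, φ i x ≤ ENNReal.ofReal (1 + 1 / ((j.2 : ℝ) + 1)) := by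
    intro j x; simp [K]
  have k1 : Antitone K := by
    rintro j j' ⟨hj1, hj2⟩ y hy
    rw [hK] at hy ⊢
    refine ⟨hy.1, fun i hi => (hy.2 i (hj1 hi)).trans ?_⟩
    apply ENNReal.ofReal_le_ofReal
    have : (j.2 : ℝ) ≤ j'.2 := by exact_mod_cast hj2
    gcongr
  have k2 : ∀ j, (K j).Nonempty := by
    rintro ⟨s, n⟩
    obtain ⟨x, hx, hx'⟩ := fin_aux C hC (fun (i : s) => φ i) (fun i => hφ i) (by
      intro c hc
      obtain ⟨x, hx, hle⟩ := h s (fun u => if hu : u ∈ s then c ⟨u, hu⟩ else 1) (by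
        intro u; split_ifs; exacts [hc _, one_pos])
      refine ⟨x, hx, ?_⟩
      rw [← Finset.sum_coe_sort s, ← Finset.sum_coe_sort s] at hle
      simpa using hle) (1 / ((n : ℝ) + 1)) (by positivity)
    exact ⟨x, (hK _ _).2 ⟨hx, fun i hi => hx' ⟨i, hi⟩⟩⟩
  have k3 : ∀ j, IsClosed (K j) := by
    intro j
    exact hCc.inter (isClosed_biInter fun i _ => hl i _)
  have k4 : ∀ j, Convex ℝ (K j) := by
    intro j x hx y hy a b ha hb hab
    rw [hK] at hx hy ⊢
    refine ⟨hC hx.1 hy.1 ha hb hab, fun i hi => (hφ i x hx.1 y hy.1 a b ha hb hab).trans ?_⟩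
    calc _ ≤ ENNReal.ofReal a * ENNReal.ofReal (1 + 1 / ((j.2 : ℝ) + 1)) +
          ENNReal.ofReal b * ENNReal.ofReal (1 + 1 / ((j.2 : ℝ) + 1)) := by
            gcongr
            exacts [hx.2 i hi, hy.2 i hi]
      _ = _ := by rw [← add_mul, ← ENNReal.ofReal_add ha hb, hab]; simp
  obtain ⟨x, hx⟩ := nested_aux K k1 k2 k3 k4 R (fun j x hx => hR x ((hK _ _).1 hx).1)
  refine ⟨x, ((hK (∅, 0) x).1 (hx _)).1, fun i => ?_⟩
  have h1 : ∀ n : ℕ, φ i x ≤ ENNReal.ofReal (1 + 1 / ((n : ℝ) + 1)) := fun n =>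
    ((hK ({i}, n) x).1 (hx _)).2 i (by simp)
  have h2 : Filter.Tendsto (fun n : ℕ => ENNReal.ofReal (1 + 1 / ((n : ℝ) + 1))) Filter.atTop
      (nhds (ENNReal.ofReal (1 + 0))) :=
    ENNReal.tendsto_ofReal (tendsto_const_nhds.add tendsto_one_div_add_atTop_nhds_zero_nat)
  simpa using ge_of_tendsto' h2 h1

theorem rpow_conv_aux (β : ℝ) (hβ : 0 < β) (s t a b : ℝ) (hs : 0 ≤ s) (ht : 0 ≤ t) (ha : 0 ≤ a)
    (hb : 0 ≤ b) (hab : a + b = 1) :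
    ENNReal.ofReal (a * s + b * t) ^ (-β) ≤
      ENNReal.ofReal a * ENNReal.ofReal s ^ (-β) + ENNReal.ofReal b * ENNReal.ofReal t ^ (-β) := by
  rcases ha.eq_or_lt with rfl | ha
  · have : b = 1 := by linarith
    simp [this]
  rcases hb.eq_or_lt with rfl | hb
  · have : a = 1 := by linarith
    simp [this]
  rcases hs.eq_or_lt with rfl | hs
  · have : ENNReal.ofReal a * ENNReal.ofReal 0 ^ (-β) = ∞ := by
      rw [ENNReal.ofReal_zero, ENNReal.zero_rpow_of_neg (by linarith), ENNReal.mul_top (by simpa)]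
    rw [this]; simp
  rcases ht.eq_or_lt with rfl | ht
  · have : ENNReal.ofReal b * ENNReal.ofReal 0 ^ (-β) = ∞ := by
      rw [ENNReal.ofReal_zero, ENNReal.zero_rpow_of_neg (by linarith), ENNReal.mul_top (by simpa)]
    rw [this]; simp
  have hpos : 0 < a * s + b * t := by positivity
  rw [ENNReal.ofReal_rpow_of_pos hpos, ENNReal.ofReal_rpow_of_pos hs, ENNReal.ofReal_rpow_of_pos ht,
    ← ENNReal.ofReal_mul ha.le, ← ENNReal.ofReal_mul hb.le,
    ← ENNReal.ofReal_add (by positivity) (by positivity)]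
  apply ENNReal.ofReal_le_ofReal
  rw [Real.rpow_def_of_pos hpos, Real.rpow_def_of_pos hs, Real.rpow_def_of_pos ht]
  have h1 := strictConcaveOn_log_Ioi.concaveOn.2 (Set.mem_Ioi.2 hs) (Set.mem_Ioi.2 ht) ha.le hb.le hab
  have h2 := convexOn_exp.2 (Set.mem_univ (Real.log s * -β)) (Set.mem_univ (Real.log t * -β))
    ha.le hb.le hab
  simp only [smul_eq_mul] at h1 h2
  refine le_trans (Real.exp_le_exp.2 ?_) h2
  nlinarith

theorem sq_conv_aux (s t a b : ℝ) (ha : 0 ≤ a) (hb : 0 ≤ b) (hab : a + b = 1) :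
    ‖a * s + b * t‖ₑ ^ 2 ≤ ENNReal.ofReal a * ‖s‖ₑ ^ 2 + ENNReal.ofReal b * ‖t‖ₑ ^ 2 := by
  simp only [← ofReal_norm, Real.norm_eq_abs]
  rw [← ENNReal.ofReal_pow (abs_nonneg _), ← ENNReal.ofReal_pow (abs_nonneg _),
    ← ENNReal.ofReal_pow (abs_nonneg _), ← ENNReal.ofReal_mul ha, ← ENNReal.ofReal_mul hb,
    ← ENNReal.ofReal_add (by positivity) (by positivity)]
  apply ENNReal.ofReal_le_ofReal
  simp only [sq_abs]
  obtain rfl : b = 1 - a := by linarith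
  nlinarith [mul_nonneg (mul_nonneg ha hb) (sq_nonneg (s - t))]

theorem closed_aux {X : Type*} [MeasurableSpace X] {μ : Measure X} (W : X → ℝ≥0∞)
    (hW : AEMeasurable W μ) (hWf : ∀ x, W x ≠ ∞) (θ : ℝ → ℝ≥0∞) (hθ : Continuous θ) (r : ℝ≥0∞) :
    IsClosed {k : Lp ℝ 2 μ | ∫⁻ x, W x * θ (k x) ∂μ ≤ r} := by
  rw [← isSeqClosed_iff_isClosed]
  intro k k₀ hk hlim
  obtain ⟨ns, -, hns⟩ := (tendstoInMeasure_of_tendsto_Lp hlim).exists_seq_tendsto_ae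
  have hm : ∀ n, AEMeasurable (fun x => W x * θ (k (ns n) x)) μ := fun n =>
    hW.mul (hθ.measurable.comp_aemeasurable (Lp.aestronglyMeasurable _).aemeasurable)
  calc ∫⁻ x, W x * θ (k₀ x) ∂μ
      = ∫⁻ x, Filter.liminf (fun n => W x * θ (k (ns n) x)) Filter.atTop ∂μ := by
        refine lintegral_congr_ae ?_
        filter_upwards [hns] with x hx
        refine (Filter.Tendsto.liminf_eq ?_).symm
        exact ENNReal.Tendsto.const_mul ((hθ.tendsto _).comp hx) (Or.inr (hWf x))
    _ ≤ Filter.liminf (fun n => ∫⁻ x, W x * θ (k (ns n) x) ∂μ) Filter.atTop :=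
        lintegral_liminf_le' hm
    _ ≤ r := by
        refine Filter.liminf_le_of_frequently_le' ?_
        exact Filter.Frequently.of_forall fun n => hk (ns n)

theorem conv_aux {X : Type*} [MeasurableSpace X] {μ : Measure X} (W : X → ℝ≥0∞)
    (hW : AEMeasurable W μ) (θ : ℝ → ℝ≥0∞) (hθ : Measurable θ) (a b : ℝ)
    (hconv : ∀ s t, 0 ≤ s → 0 ≤ t →
      θ (a * s + b * t) ≤ ENNReal.ofReal a * θ s + ENNReal.ofReal b * θ t)
    (k l : Lp ℝ 2 μ) (hk : 0 ≤ k) (hl : 0 ≤ l) :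
    ∫⁻ x, W x * θ ((a • k + b • l : Lp ℝ 2 μ) x) ∂μ ≤
      ENNReal.ofReal a * ∫⁻ x, W x * θ (k x) ∂μ + ENNReal.ofReal b * ∫⁻ x, W x * θ (l x) ∂μ := by
  have hm : ∀ k : Lp ℝ 2 μ, AEMeasurable (fun x => W x * θ (k x)) μ := fun k =>
    hW.mul (hθ.comp_aemeasurable (Lp.aestronglyMeasurable _).aemeasurable)
  rw [← lintegral_const_mul'' _ (hm k), ← lintegral_const_mul'' _ (hm l),
    ← lintegral_add_left' ((hm k).const_mul _)]
  refine lintegral_mono_ae ?_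
  filter_upwards [Lp.coeFn_add (a • k) (b • l), Lp.coeFn_smul a k, Lp.coeFn_smul b l,
    (Lp.coeFn_nonneg k).2 hk, (Lp.coeFn_nonneg l).2 hl] with x h1 h2 h3 h4 h5
  rw [h1, Pi.add_apply, h2, h3]
  simp only [Pi.smul_apply, smul_eq_mul]
  calc _ ≤ W x * (ENNReal.ofReal a * θ (k x) + ENNReal.ofReal b * θ (l x)) := by
        gcongr; exact hconv _ _ h4 h5
    _ = _ := by ring

theorem L2_aux {X : Type*} [MeasurableSpace X] (μ : Measure X) {I U : Type*} [Countable I]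
    (s : I → Set X) (hs : ∀ a, MeasurableSet (s a)) (hsU : ⋃ a, s a = Set.univ)
    (e : I → ℝ≥0∞) (he : ∑' a, e a ≠ ∞) (W : U → X → ℝ≥0∞) (hW : ∀ u, AEMeasurable (W u) μ)
    (hWf : ∀ u x, W u x ≠ ∞) (β : ℝ) (hβ : 0 < β)
    (h : ∀ (S : Finset U) (c : U → ℝ), (∀ u, 0 < c u) → ∃ k : X → ℝ, AEStronglyMeasurable k μ ∧
      (∀ x, 0 ≤ k x) ∧ (∀ a, ∫⁻ x in s a, ‖k x‖ₑ ^ 2 ∂μ ≤ e a) ∧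
      ∫⁻ x, ∑ u ∈ S, ENNReal.ofReal (c u) * (W u x * ENNReal.ofReal (k x) ^ (-β)) ∂μ
        ≤ ENNReal.ofReal (∑ u ∈ S, c u)) :
    ∃ k : X → ℝ, Measurable k ∧ (∀ᵐ x ∂μ, 0 ≤ k x) ∧ (∀ a, ∫⁻ x in s a, ‖k x‖ₑ ^ 2 ∂μ ≤ e a) ∧
      ∀ u, ∫⁻ x, W u x * ENNReal.ofReal (k x) ^ (-β) ∂μ ≤ 1 := by
  classical
  have hθ1 : Continuous fun t : ℝ => ‖t‖ₑ ^ 2 := by fun_prop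
  have hθ2 : Continuous fun t : ℝ => ENNReal.ofReal t ^ (-β) :=
    ENNReal.continuous_rpow_const.comp ENNReal.continuous_ofReal
  have hind : ∀ a (k : X → ℝ), ∫⁻ x in s a, ‖k x‖ₑ ^ 2 ∂μ =
      ∫⁻ x, (s a).indicator 1 x * ‖k x‖ₑ ^ 2 ∂μ := by
    intro a k
    rw [← lintegral_indicator (hs a)]
    congr 1 with x
    by_cases hx : x ∈ s a <;> simp [hx]
  have hWi : ∀ a, AEMeasurable ((s a).indicator (1 : X → ℝ≥0∞)) μ := fun a =>
    (measurable_one.indicator (hs a)).aemeasurable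
  have hWif : ∀ a x, (s a).indicator (1 : X → ℝ≥0∞) x ≠ ∞ := by
    intro a x; by_cases hx : x ∈ s a <;> simp [hx]
  let C : Set (Lp ℝ 2 μ) := Set.Ici 0 ∩ ⋂ a, {k | ∫⁻ x, (s a).indicator 1 x * ‖k x‖ₑ ^ 2 ∂μ ≤ e a}
  have hCm : ∀ k, k ∈ C ↔ 0 ≤ k ∧ ∀ a, ∫⁻ x, (s a).indicator 1 x * ‖k x‖ₑ ^ 2 ∂μ ≤ e a := by
    intro k; simp [C]
  have hnorm : ∀ k : X → ℝ, (∀ a, ∫⁻ x in s a, ‖k x‖ₑ ^ 2 ∂μ ≤ e a) →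
      eLpNorm k 2 μ ≤ (∑' a, e a) ^ (1 / (2:ℝ)) := by
    intro k hk
    rw [eLpNorm_eq_lintegral_rpow_enorm_toReal (by norm_num) (by norm_num)]
    simp only [ENNReal.toReal_ofNat, ENNReal.rpow_ofNat]
    gcongr
    rw [← setLIntegral_univ, ← hsU]
    exact (lintegral_iUnion_le _ _).trans (ENNReal.tsum_le_tsum hk)
  have hfin : (∑' a, e a) ^ (1 / (2:ℝ)) ≠ ∞ := ENNReal.rpow_ne_top_of_nonneg (by norm_num) he
  have c1 : Convex ℝ C := by
    intro k hk l hl a b ha hb hab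
    rw [hCm] at hk hl ⊢
    refine ⟨?_, fun i => ?_⟩
    · rw [← Lp.coeFn_nonneg]
      filter_upwards [Lp.coeFn_add (a • k) (b • l), Lp.coeFn_smul a k, Lp.coeFn_smul b l,
        (Lp.coeFn_nonneg k).2 hk.1, (Lp.coeFn_nonneg l).2 hl.1] with x h1 h2 h3 h4 h5
      rw [h1, Pi.add_apply, h2, h3]
      exact add_nonneg (mul_nonneg ha h4) (mul_nonneg hb h5)
    · refine (conv_aux _ (hWi i) (fun t => ‖t‖ₑ ^ 2) hθ1.measurable a b
        (fun s t _ _ => sq_conv_aux s t a b ha hb hab) k l hk.1 hl.1).trans ?_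
      calc _ ≤ ENNReal.ofReal a * e i + ENNReal.ofReal b * e i := by
            gcongr
            exacts [hk.2 i, hl.2 i]
        _ = e i := by rw [← add_mul, ← ENNReal.ofReal_add ha hb, hab]; simp
  have c2 : IsClosed C :=
    isClosed_Ici.inter (isClosed_iInter fun a => closed_aux _ (hWi a) (hWif a) _ hθ1 _)
  have c3 : ∀ k ∈ C, ‖k‖ ≤ ((∑' a, e a) ^ (1 / (2:ℝ))).toReal := by
    intro k hk
    rw [hCm] at hk
    rw [Lp.norm_def]
    exact ENNReal.toReal_mono hfin (hnorm _ fun a => by rw [hind]; exact hk.2 a)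
  obtain ⟨k, hk, hk'⟩ := minimax_aux C c1 c2 ((∑' a, e a) ^ (1 / (2:ℝ))).toReal c3
    (fun u k => ∫⁻ x, W u x * ENNReal.ofReal (k x) ^ (-β) ∂μ)
    (fun u k hk l hl a b ha hb hab => conv_aux _ (hW u) (fun t => ENNReal.ofReal t ^ (-β))
      hθ2.measurable a b (fun s t hs ht => rpow_conv_aux β hβ s t a b hs ht ha hb hab) k l
      ((hCm _).1 hk).1 ((hCm _).1 hl).1)
    (fun u r => closed_aux _ (hW u) (hWf u) _ hθ2 r)
    (by
      intro S c hc
      obtain ⟨k, hkm, hk0, hke, hkS⟩ := h S c hc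
      have hmem : MemLp k 2 μ := ⟨hkm, (hnorm k hke).trans_lt hfin.lt_top⟩
      have hae := hmem.coeFn_toLp
      refine ⟨hmem.toLp k, (hCm _).2 ⟨?_, fun a => ?_⟩, ?_⟩
      · rw [← Lp.coeFn_nonneg]
        filter_upwards [hae] with x hx
        rw [hx]; exact hk0 x
      · refine le_trans (le_of_eq ?_) (hke a)
        rw [hind]
        refine lintegral_congr_ae ?_
        filter_upwards [hae] with x hx
        rw [hx]
      · refine le_trans (le_of_eq ?_) hkS
        have hm : ∀ u, AEMeasurable (fun x => W u x * ENNReal.ofReal (k x) ^ (-β)) μ := fun u =>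
          (hW u).mul (hθ2.measurable.comp_aemeasurable hkm.aemeasurable)
        rw [lintegral_finsetSum' _ (fun u _ => (hm u).const_mul _)]
        refine Finset.sum_congr rfl fun u _ => ?_
        rw [lintegral_const_mul'' _ (hm u)]
        congr 1
        refine lintegral_congr_ae ?_
        filter_upwards [hae] with x hx
        rw [hx])
  rw [hCm] at hk
  exact ⟨k, (Lp.stronglyMeasurable k).measurable, (Lp.coeFn_nonneg k).2 hk.1,
    fun a => by rw [hind]; exact hk.2 a, hk'⟩

def cubeIdx {n : ℕ} (x : Fin n → ℝ) : Fin n → ℤ := fun i => ⌈x i - 1 / 2⌉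

theorem mem_cube_iff {n : ℕ} (a : Fin n → ℤ) (x : Fin n → ℝ) : x ∈ cube a ↔ cubeIdx x = a := by
  unfold cube cubeIdx
  rw [funext_iff]
  simp only [Set.mem_ofPred_eq, Int.ceil_eq_iff]
  refine forall_congr' fun i => ?_
  constructor <;> rintro ⟨h1, h2⟩ <;> constructor <;> linarith

theorem measurable_cubeIdx {n : ℕ} : Measurable (cubeIdx (n := n)) := by
  unfold cubeIdx
  refine measurable_pi_lambda _ fun i => ?_
  exact Int.measurable_ceil.comp ((measurable_pi_apply i).sub_const _)

theorem measurableSet_cube {n : ℕ} (a : Fin n → ℤ) : MeasurableSet (cube a) := by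
  have : cube a = cubeIdx ⁻¹' {a} := by ext x; simp [mem_cube_iff]
  rw [this]
  exact measurable_cubeIdx (measurableSet_singleton a)

theorem pieceNorm_rpow {n : ℕ} {F : Type*} [NormedAddCommGroup F] (r : ℝ) (hr : 0 < r)
    (f : (Fin n → ℝ) → F) (a : Fin n → ℤ) :
    pieceNorm r f a ^ r = ∫⁻ x in cube a, ‖f x‖ₑ ^ r := by
  unfold pieceNorm
  rw [eLpNorm_indicator_eq_eLpNorm_restrict (measurableSet_cube a),
    eLpNorm_eq_lintegral_rpow_enorm_toReal (by simpa using hr) (by simp),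
    ENNReal.toReal_ofReal hr.le, ← ENNReal.rpow_mul, one_div, inv_mul_cancel₀ hr.ne',
    ENNReal.rpow_one]

theorem real_id_aux (p q e l M G : ℝ) (hq0 : 0 < q) (hpq : 2 * p / q + p = 2)
    (he : 0 < e) (hl : 0 < l) (hM : 0 < M) (hG : 0 < G) :
    G ^ 2 * ((√e * l ^ (q / 2)) ^ (4 / q) * (√e * M ^ (-(p / 2)) * G ^ (p / 2)) ^ (-(4 / q)))
      = l ^ 2 * M ^ (2 * p / q) * G ^ p := by
  have hs : 0 < √e := Real.sqrt_pos.2 he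
  rw [Real.mul_rpow hs.le (by positivity), Real.mul_rpow (by positivity) (by positivity),
    Real.mul_rpow hs.le (by positivity), ← Real.rpow_mul hl.le, ← Real.rpow_mul hM.le,
    ← Real.rpow_mul hG.le]
  have h1 : q / 2 * (4 / q) = (2 : ℕ) := by field_simp; norm_num
  have h2 : -(p / 2) * -(4 / q) = 2 * p / q := by field_simp; norm_num
  have h3 : p / 2 * -(4 / q) = p - (2 : ℕ) := by
    have : p / 2 * -(4 / q) = -(2 * p / q) := by field_simp; norm_num
    rw [this]; push_cast; linarith
  rw [h1, h2, h3, Real.rpow_natCast, Real.rpow_sub_natCast hG.ne', Real.rpow_neg hs.le]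
  field_simp

theorem g_id_aux (q V k : ℝ) (hq0 : 0 < q) (hV : 0 < V) (hk : 0 < k) :
    (((V⁻¹ * k) ^ (2 / q)) ^ 2)⁻¹ = V ^ (4 / q) * k ^ (-(4 / q)) := by
  rw [← Real.rpow_natCast, ← Real.rpow_mul (by positivity)]
  have h1 : 2 / q * ((2:ℕ):ℝ) = 4 / q := by push_cast; ring
  rw [h1, Real.mul_rpow (by positivity) hk.le, mul_inv, Real.rpow_neg hk.le,
    Real.inv_rpow hV.le, inv_inv]

/-- The near-optimal density for a single convex combination. -/
theorem opt_aux {n : ℕ} (p q : ℝ) (hp1 : 1 < p) (hq0 : 0 < q) (hpq : 2 * p / q + p = 2)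
    (lam : (Fin n → ℤ) → ℝ) (hlam : ∀ a, 0 < lam a) (e : (Fin n → ℤ) → ℝ) (he : ∀ a, 0 < e a)
    (G : (Fin n → ℝ) → ℝ) (hG : AEStronglyMeasurable G volume) (hG0 : ∀ x, 0 ≤ G x)
    (hfin : ∀ a, pieceNorm p G a < ∞)
    (hsum : Summable fun a => lam a ^ 2 * (pieceNorm p G a).toReal ^ 2) :
    ∃ k : (Fin n → ℝ) → ℝ, AEStronglyMeasurable k volume ∧
      (∀ x, 0 ≤ k x) ∧ (∀ a, ∫⁻ x in cube a, ‖k x‖ₑ ^ 2 ≤ ENNReal.ofReal (e a)) ∧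
      ∫⁻ x, ENNReal.ofReal (G x ^ 2) *
        (ENNReal.ofReal (√(e (cubeIdx x)) * lam (cubeIdx x) ^ (q / 2)) ^ (4 / q) *
          ENNReal.ofReal (k x) ^ (-(4 / q)))
        ≤ ENNReal.ofReal (LnormSq p lam G) := by
  have hp0 : 0 < p := by linarith
  set M : (Fin n → ℤ) → ℝ := fun a => (pieceNorm p G a).toReal with hM
  have hM0 : ∀ a, 0 ≤ M a := fun a => ENNReal.toReal_nonneg
  have hMint : ∀ a, ∫⁻ x in cube a, ‖G x‖ₑ ^ p = ENNReal.ofReal (M a ^ p) := by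
    intro a
    rw [← pieceNorm_rpow p hp0, ← ENNReal.ofReal_rpow_of_nonneg (hM0 a) hp0.le,
      ENNReal.ofReal_toReal (hfin a).ne]
  have hGp : ∀ x, ‖G x‖ₑ ^ p = ENNReal.ofReal (G x ^ p) := fun x => by
    rw [Real.enorm_eq_ofReal (hG0 x), ENNReal.ofReal_rpow_of_nonneg (hG0 x) hp0.le]
  have hGm : AEMeasurable (fun x => ‖G x‖ₑ ^ p) volume := hG.enorm.pow_const _
  refine ⟨fun x => √(e (cubeIdx x)) * M (cubeIdx x) ^ (-(p / 2)) * G x ^ (p / 2), ?_, ?_, ?_, ?_⟩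
  · have h1 : Measurable fun x : Fin n → ℝ => √(e (cubeIdx x)) * M (cubeIdx x) ^ (-(p / 2)) :=
      (measurable_of_countable fun a => √(e a) * M a ^ (-(p / 2))).comp measurable_cubeIdx
    exact (h1.aemeasurable.mul (hG.aemeasurable.pow_const _)).aestronglyMeasurable
  · intro x
    have := hM0 (cubeIdx x)
    have := hG0 x
    positivity
  · intro a
    have h1 : ∀ x ∈ cube a, ‖√(e (cubeIdx x)) * M (cubeIdx x) ^ (-(p / 2)) * G x ^ (p / 2)‖ₑ ^ 2
        = ENNReal.ofReal (e a * M a ^ (-p)) * ‖G x‖ₑ ^ p := by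
      intro x hx
      rw [(mem_cube_iff a x).1 hx]
      have := hM0 a
      have := hG0 x
      rw [Real.enorm_eq_ofReal (by positivity), ← ENNReal.ofReal_pow (by positivity), hGp,
        ← ENNReal.ofReal_mul (mul_nonneg (he a).le (by positivity))]
      congr 1
      rw [mul_pow, mul_pow, Real.sq_sqrt (he a).le, ← Real.rpow_natCast (M a ^ _),
        ← Real.rpow_natCast (G x ^ _), ← Real.rpow_mul (hM0 a), ← Real.rpow_mul (hG0 x)]
      congr 3 <;> push_cast <;> ring
    rw [setLIntegral_congr_fun (measurableSet_cube a) h1, lintegral_const_mul'' _ hGm.restrict,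
      hMint, ← ENNReal.ofReal_mul (mul_nonneg (he a).le (Real.rpow_nonneg (hM0 a) _))]
    apply ENNReal.ofReal_le_ofReal
    rcases (hM0 a).eq_or_lt with h0 | h0
    · rw [← h0, Real.zero_rpow hp0.ne']; simp [(he a).le]
    · rw [Real.rpow_neg h0.le]
      have : 0 < M a ^ p := Real.rpow_pos_of_pos h0 _
      rw [mul_assoc, inv_mul_cancel₀ this.ne', mul_one]
  · have hU : ⋃ a, cube (n := n) a = Set.univ := by
      ext x; simp [mem_cube_iff]
    rw [← setLIntegral_univ, ← hU]
    refine (lintegral_iUnion_le _ _).trans ?_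
    unfold LnormSq
    rw [ENNReal.ofReal_tsum_of_nonneg (fun a => by positivity) hsum]
    refine ENNReal.tsum_le_tsum fun a => ?_
    have h1 : ∀ᵐ x ∂(volume.restrict (cube a)), ENNReal.ofReal (G x ^ 2) *
        (ENNReal.ofReal (√(e (cubeIdx x)) * lam (cubeIdx x) ^ (q / 2)) ^ (4 / q) *
          ENNReal.ofReal (√(e (cubeIdx x)) * M (cubeIdx x) ^ (-(p / 2)) * G x ^ (p / 2))
            ^ (-(4 / q))) ≤ ENNReal.ofReal (lam a ^ 2 * M a ^ (2 * p / q)) * ‖G x‖ₑ ^ p := by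
      have hz : ∀ᵐ x ∂(volume.restrict (cube a)), M a = 0 → G x = 0 := by
        by_cases h0 : M a = 0
        · have h2 := hMint a
          rw [h0, Real.zero_rpow hp0.ne', ENNReal.ofReal_zero,
            lintegral_eq_zero_iff' hGm.restrict] at h2
          filter_upwards [h2] with x hx _
          simpa [hp0, hp0.le, not_lt] using hx
        · exact Filter.Eventually.of_forall fun x h => absurd h h0
      filter_upwards [hz, ae_restrict_mem (measurableSet_cube a)] with x hx hxa
      rw [(mem_cube_iff a x).1 hxa]
      rcases (hG0 x).eq_or_lt with hx0 | hx0
      · rw [← hx0]; simp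
      · have hMp : 0 < M a := (hM0 a).lt_of_ne fun h => hx0.ne' (hx h.symm)
        have := he a
        have := hlam a
        have := Real.sqrt_pos.2 (he a)
        rw [hGp, ENNReal.ofReal_rpow_of_pos (by positivity), ENNReal.ofReal_rpow_of_pos (by positivity),
          ← ENNReal.ofReal_mul (by positivity), ← ENNReal.ofReal_mul (by positivity),
          ← ENNReal.ofReal_mul (by positivity),
          real_id_aux p q (e a) (lam a) (M a) (G x) hq0 hpq (he a) (hlam a) hMp hx0]
    refine (lintegral_mono_ae h1).trans (le_of_eq ?_)
    rw [lintegral_const_mul'' _ hGm.restrict, hMint, ← ENNReal.ofReal_mul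
      (mul_nonneg (sq_nonneg _) (Real.rpow_nonneg (hM0 a) _)), mul_assoc,
      ← Real.rpow_add' (hM0 a) (by rw [hpq]; norm_num), hpq]
    norm_num [hM]

/-- If `(f^u)_{u ∈ U}` is a family in `𝓛` such that
`‖(Σ α_u² |f^u|²)^{1/2}‖_𝓛 ≤ (Σ α_u²)^{1/2}` for all finitely supported families of
non-negative reals `α`, then there is a single `g ∈ 𝓜₁⁺` with, for every `u`:
`f^u = 0` a.e. on `{g = 0}` and `∫_{g>0} |f^u|²/g² ≤ 1`. -/
theorem stmt17 {n : ℕ} (hn : 0 < n) (p q : ℝ) (hp1 : 1 < p) (hp2 : p < 2)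
    (hq : 1 / p = 1 / 2 + 1 / q)
    (lam : (Fin n → ℤ) → ℝ) (hlam : ∀ a, 0 < lam a)
    {U : Type*} (f : U → (Fin n → ℝ) → ℂ) (hfmem : ∀ u, MemL p lam (f u))
    (hbound : ∀ (s : Finset U) (α : U → ℝ), (∀ u, 0 ≤ α u) →
      (∀ a, pieceNorm p
          (fun x => Real.sqrt (∑ u ∈ s, α u ^ 2 * ‖f u x‖ ^ 2)) a < ∞) ∧
      Summable (fun a => lam a ^ 2 * (pieceNorm p
          (fun x => Real.sqrt (∑ u ∈ s, α u ^ 2 * ‖f u x‖ ^ 2)) a).toReal ^ 2) ∧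
      LnormSq p lam (fun x => Real.sqrt (∑ u ∈ s, α u ^ 2 * ‖f u x‖ ^ 2))
        ≤ ∑ u ∈ s, α u ^ 2) :
    ∃ g : (Fin n → ℝ) → ℝ, Measurable g ∧ (∀ᵐ x ∂volume, 0 ≤ g x) ∧
      (∀ a, ENNReal.ofReal (lam a) * pieceNorm q g a ≤ 1) ∧
      ∀ u : U, (∀ᵐ x ∂volume, g x = 0 → f u x = 0) ∧
        (∫⁻ x in {x | g x ≠ 0}, (‖f u x‖₊ : ℝ≥0∞) ^ 2 / ENNReal.ofReal (g x) ^ 2 ∂volume)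
          ≤ 1 := by
  have hp0 : 0 < p := by linarith
  have hq0 : 0 < q := by
    have h1 : 1 / 2 < 1 / p := one_div_lt_one_div_of_lt hp0 hp2
    have h2 : 0 < 1 / q := by linarith
    exact one_div_pos.1 h2
  have hpq : 2 * p / q + p = 2 := by
    have h1 : 2 * p * (1 / p) = 2 * p * (1 / 2 + 1 / q) := by rw [hq]
    have h2 : 2 * p * (1 / p) = 2 := by field_simp
    rw [h2] at h1
    have h3 : 2 * p * (1 / 2 + 1 / q) = 2 * p / q + p := by ring
    linarith
  obtain ⟨e, he, hesum⟩ := ENNReal.exists_pos_sum_of_countable (ε := 1) one_ne_zero (Fin n → ℤ)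
  set V : (Fin n → ℤ) → ℝ := fun a => √(e a) * lam a ^ (q / 2) with hV
  have hVpos : ∀ a, 0 < V a := fun a =>
    mul_pos (Real.sqrt_pos.2 (he a)) (Real.rpow_pos_of_pos (hlam a) _)
  have hVm : Measurable fun x : Fin n → ℝ => V (cubeIdx x) :=
    (measurable_of_countable V).comp measurable_cubeIdx
  have hU : ⋃ a, cube (n := n) a = Set.univ := by
    ext x; simp [mem_cube_iff]
  have hβ : 0 < 4 / q := by positivity
  obtain ⟨k, hkm, hk0, hke, hkW⟩ := L2_aux (volume : Measure (Fin n → ℝ)) cube measurableSet_cube hU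
    (fun a => (e a : ℝ≥0∞)) (hesum.trans ENNReal.one_lt_top).ne
    (fun u x => ‖f u x‖ₑ ^ 2 * ENNReal.ofReal (V (cubeIdx x)) ^ (4 / q))
    (fun u => ((hfmem u).1.enorm.pow_const 2).mul
      (hVm.ennreal_ofReal.pow_const _).aemeasurable)
    (fun u x => ENNReal.mul_ne_top (by simp)
      (ENNReal.rpow_ne_top_of_nonneg hβ.le ENNReal.ofReal_ne_top)) (4 / q) hβ (by
    intro S c hc
    have hα : ∀ u, √(c u) ^ 2 = c u := fun u => Real.sq_sqrt (hc u).le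
    obtain ⟨b1, b2, b3⟩ := hbound S (fun u => √(c u)) (fun u => Real.sqrt_nonneg _)
    simp only [hα] at b1 b2 b3
    obtain ⟨k, hk1, hk2, hk3, hk4⟩ := opt_aux p q hp1 hq0 hpq lam hlam (fun a => (e a : ℝ)) he
      (fun x => √(∑ u ∈ S, c u * ‖f u x‖ ^ 2))
      (by
        have : AEMeasurable (fun x => ∑ u ∈ S, c u * ‖f u x‖ ^ 2) volume :=
          Finset.aemeasurable_fun_sum _ fun u _ => ((hfmem u).1.norm.aemeasurable.pow_const 2).const_mul _
        exact (Real.continuous_sqrt.measurable.comp_aemeasurable this).aestronglyMeasurable)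
      (fun x => Real.sqrt_nonneg _) b1 b2
    refine ⟨k, hk1, hk2, fun a => by simpa using hk3 a, ?_⟩
    refine le_trans (le_of_eq ?_) (hk4.trans (ENNReal.ofReal_le_ofReal b3))
    refine lintegral_congr fun x => ?_
    have hnn : ∀ u ∈ S, 0 ≤ c u * ‖f u x‖ ^ 2 := fun u _ => mul_nonneg (hc u).le (by positivity)
    rw [Real.sq_sqrt (Finset.sum_nonneg hnn), ENNReal.ofReal_sum_of_nonneg hnn, Finset.sum_mul]
    refine Finset.sum_congr rfl fun u _ => ?_
    rw [ENNReal.ofReal_mul (hc u).le, ENNReal.ofReal_pow (norm_nonneg _), ofReal_norm]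
    ring)
  refine ⟨fun x => ((V (cubeIdx x))⁻¹ * max (k x) 0) ^ (2 / q), ?_, ?_, ?_, ?_⟩
  · exact (hVm.inv.mul (hkm.max measurable_const)).pow_const _
  · refine Filter.Eventually.of_forall fun x => ?_
    have := hVpos (cubeIdx x)
    positivity
  · intro a
    set g : (Fin n → ℝ) → ℝ := fun x => ((V (cubeIdx x))⁻¹ * max (k x) 0) ^ (2 / q) with hg
    rw [← ENNReal.rpow_le_rpow_iff hq0, ENNReal.one_rpow, ENNReal.mul_rpow_of_nonneg _ _ hq0.le,
      pieceNorm_rpow q hq0]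
    have hle : ∫⁻ x in cube a, ‖g x‖ₑ ^ q ≤
        ∫⁻ x in cube a, ENNReal.ofReal ((V a ^ 2)⁻¹) * ‖k x‖ₑ ^ 2 := by
      refine setLIntegral_mono' (measurableSet_cube a) fun x hx => ?_
      have hv := hVpos a
      simp only [hg]
      rw [(mem_cube_iff a x).1 hx, Real.enorm_eq_ofReal (by positivity),
        ENNReal.ofReal_rpow_of_nonneg (by positivity) hq0.le, ← Real.rpow_mul (by positivity),
        div_mul_cancel₀ _ hq0.ne', ← ofReal_norm, ← ENNReal.ofReal_pow (norm_nonneg _),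
        ← ENNReal.ofReal_mul (by positivity)]
      apply ENNReal.ofReal_le_ofReal
      rw [Real.rpow_two, mul_pow, inv_pow]
      gcongr
      exact max_le (le_abs_self _) (abs_nonneg _)
    calc _ ≤ ENNReal.ofReal (lam a) ^ q * (ENNReal.ofReal ((V a ^ 2)⁻¹) * (e a : ℝ≥0∞)) := by
          refine mul_le_mul_right (hle.trans ?_) _
          rw [lintegral_const_mul _ (by fun_prop)]
          exact mul_le_mul_right (hke a) _
      _ = 1 := by
          have hl := hlam a
          have hea : (0:ℝ) < e a := he a
          have hlq := Real.rpow_pos_of_pos hl q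
          rw [← ENNReal.ofReal_coe_nnreal (p := e a), ENNReal.ofReal_rpow_of_pos hl,
            ← ENNReal.ofReal_mul (by positivity), ← ENNReal.ofReal_mul (by positivity)]
          have : V a ^ 2 = e a * lam a ^ q := by
            simp only [hV]
            rw [mul_pow, Real.sq_sqrt hea.le, ← Real.rpow_natCast (lam a ^ _), ← Real.rpow_mul hl.le]
            congr 2; push_cast; ring
          rw [this, ← ENNReal.ofReal_one]
          congr 1
          field_simp
  · intro u
    have hpos : ∀ x, ((V (cubeIdx x))⁻¹ * max (k x) 0) ^ (2 / q) ≠ 0 ↔ 0 < k x := by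
      intro x
      have hv := hVpos (cubeIdx x)
      constructor
      · intro h
        by_contra hk
        apply h
        rw [max_eq_right (not_lt.1 hk), mul_zero, Real.zero_rpow (by positivity)]
      · intro h
        have : 0 < max (k x) 0 := lt_max_of_lt_left h
        positivity
    refine ⟨?_, ?_⟩
    · have hm : AEMeasurable (fun x => ‖f u x‖ₑ ^ 2 * ENNReal.ofReal (V (cubeIdx x)) ^ (4 / q) *
          ENNReal.ofReal (k x) ^ (-(4 / q))) volume :=
        (((hfmem u).1.enorm.pow_const 2).mul (hVm.ennreal_ofReal.pow_const _).aemeasurable).mul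
          (hkm.ennreal_ofReal.pow_const _).aemeasurable
      filter_upwards [ae_lt_top' hm ((hkW u).trans_lt ENNReal.one_lt_top).ne] with x hx hgx
      have hk : k x ≤ 0 := by
        by_contra hk
        exact (hpos x).2 (not_le.1 hk) hgx
      by_contra hf
      rw [ENNReal.ofReal_of_nonpos hk, ENNReal.zero_rpow_of_neg (by linarith),
        ENNReal.mul_top] at hx
      · exact lt_irrefl _ hx
      · refine mul_ne_zero (by simpa using hf) ?_
        rw [ENNReal.ofReal_rpow_of_pos (hVpos _)]
        simpa using Real.rpow_pos_of_pos (hVpos _) _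
    · refine le_trans ?_ (hkW u)
      refine le_trans ?_ (setLIntegral_le_lintegral
        {x | ((V (cubeIdx x))⁻¹ * max (k x) 0) ^ (2 / q) ≠ 0} _)
      have hms : MeasurableSet {x | ((V (cubeIdx x))⁻¹ * max (k x) 0) ^ (2 / q) ≠ 0} := by
        simp only [hpos]
        exact measurableSet_lt measurable_const hkm
      refine setLIntegral_mono' hms fun x hx => le_of_eq ?_
      have hkx : 0 < k x := (hpos x).1 hx
      have hv := hVpos (cubeIdx x)
      beta_reduce
      rw [max_eq_left hkx.le, ← ENNReal.ofReal_pow (by positivity), div_eq_mul_inv,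
        ← ENNReal.ofReal_inv_of_pos (by positivity), g_id_aux q _ _ hq0 hv hkx,
        ENNReal.ofReal_mul (by positivity), ENNReal.ofReal_rpow_of_pos hv,
        ENNReal.ofReal_rpow_of_pos hkx, mul_assoc]
      rfl

end
end

section
/- Let 𝓗 be a complex Hilbert space and T : 𝓗 → 𝓛 a bounded linear operator. Then there exist a function g ∈ 𝓜 with g ≥ 0 a.e. and a bounded linear operator R : 𝓗 → L²(ℝⁿ) such that for every u ∈ 𝓗 one has Tu = g·(Ru) almost everywhere. -/
open MeasureTheory
open scoped ENNReal

noncomputable section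

theorem directed_inter {E ι : Type*} [NormedAddCommGroup E] [InnerProductSpace ℝ E] [CompleteSpace E]
    [SemilatticeSup ι] [Nonempty ι] (C : ι → Set E) (hanti : Antitone C)
    (hne : ∀ i, (C i).Nonempty) (hcl : ∀ i, IsClosed (C i)) (hco : ∀ i, Convex ℝ (C i))
    (R : ℝ) (hR : ∀ i, ∀ x ∈ C i, ‖x‖ ≤ R) : ∃ x, ∀ i, x ∈ C i := by
  have h1 : ∀ i, ∃ v ∈ C i, ∀ w ∈ C i, ‖v‖ ≤ ‖w‖ := by
    intro i
    obtain ⟨v, hv, hv2⟩ := exists_norm_eq_iInf_of_complete_convex (hne i) (hcl i).isComplete (hco i) 0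
    refine ⟨v, hv, fun w hw => ?_⟩
    simp only [zero_sub, norm_neg] at hv2
    rw [hv2]
    exact ciInf_le (f := fun w : C i => ‖(w : E)‖) ⟨0, by rintro _ ⟨w, rfl⟩; exact norm_nonneg _⟩ ⟨w, hw⟩
  choose x hx hmin using h1
  have key : ∀ i j, i ≤ j → ‖x i - x j‖ ^ 2 ≤ 2 * (‖x j‖ ^ 2 - ‖x i‖ ^ 2) := by
    intro i j hij
    have hj : x j ∈ C i := hanti hij (hx j)
    have hm := hmin i _ ((hco i) (hx i) hj (by norm_num : (0:ℝ) ≤ 1/2) (by norm_num : (0:ℝ) ≤ 1/2) (by norm_num))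
    rw [← smul_add, norm_smul] at hm
    have hp := parallelogram_law_with_norm ℝ (x i) (x j)
    norm_num at hm
    have : (2 * ‖x i‖)^2 ≤ ‖x i + x j‖^2 := by
      apply pow_le_pow_left₀ (by positivity); linarith
    nlinarith
  have hmono : Monotone fun i => ‖x i‖ ^ 2 := by
    intro i j hij
    have := key i j hij
    have := sq_nonneg (‖x i - x j‖)
    simp only
    linarith
  have hbdd : BddAbove (Set.range fun i => ‖x i‖ ^ 2) := by
    refine ⟨R^2, ?_⟩
    rintro _ ⟨i, rfl⟩
    exact pow_le_pow_left₀ (norm_nonneg _) (hR i _ (hx i)) 2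
  have hc : CauchySeq x := by
    rw [Metric.cauchySeq_iff']
    intro ε hε
    have ht := (tendsto_atTop_ciSup hmono hbdd).cauchySeq
    rw [Metric.cauchySeq_iff'] at ht
    obtain ⟨N, hN⟩ := ht (ε^2/2) (by positivity)
    refine ⟨N, fun j hj => ?_⟩
    have h1 := hN j hj
    rw [Real.dist_eq] at h1
    have h2 := key N j hj
    have h3 := (abs_lt.1 h1).2
    rw [dist_comm, dist_eq_norm]
    apply lt_of_pow_lt_pow_left₀ 2 hε.le
    linarith
  obtain ⟨y, hy⟩ := cauchySeq_tendsto_of_complete hc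
  refine ⟨y, fun i => (hcl i).mem_of_tendsto hy ?_⟩
  filter_upwards [Filter.eventually_ge_atTop i] with j hj
  exact hanti hj (hx j)

/-- signed sum -/
def sgnSum {ι E : Type*} [DecidableEq ι] [AddCommGroup E] (s t : Finset ι) (z : ι → E) : E :=
  ∑ i ∈ s, (if i ∈ t then z i else - z i)

theorem sgnSum_insert_left {ι E : Type*} [DecidableEq ι] [AddCommGroup E] {s t : Finset ι} {a : ι}
    (ha : a ∉ s) (ht : t ⊆ s) (z : ι → E) : sgnSum (insert a s) t z = sgnSum s t z - z a := by
  unfold sgnSum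
  rw [Finset.sum_insert ha, if_neg (fun h => ha (ht h))]
  abel

theorem sgnSum_insert_both {ι E : Type*} [DecidableEq ι] [AddCommGroup E] {s t : Finset ι} {a : ι}
    (ha : a ∉ s) (z : ι → E) :
    sgnSum (insert a s) (insert a t) z = sgnSum s t z + z a := by
  unfold sgnSum
  rw [Finset.sum_insert ha, if_pos (Finset.mem_insert_self _ _), add_comm]
  congr 1
  apply Finset.sum_congr rfl
  intro i hi
  have : i ≠ a := fun h => ha (h ▸ hi)
  simp [this]

theorem rad_two {ι E : Type*} [DecidableEq ι] [NormedAddCommGroup E] [InnerProductSpace ℂ E]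
    (s : Finset ι) (z : ι → E) :
    ∑ t ∈ s.powerset, ‖sgnSum s t z‖ ^ 2 = 2 ^ s.card * ∑ i ∈ s, ‖z i‖ ^ 2 := by
  induction s using Finset.induction_on with
  | empty => simp [sgnSum]
  | insert a s ha ih =>
    rw [Finset.sum_powerset_insert ha, ← Finset.sum_add_distrib, Finset.card_insert_of_notMem ha,
      Finset.sum_insert ha]
    have : ∀ t ∈ s.powerset, ‖sgnSum (insert a s) t z‖ ^ 2 + ‖sgnSum (insert a s) (insert a t) z‖ ^ 2
        = 2 * ‖sgnSum s t z‖ ^ 2 + 2 * ‖z a‖ ^ 2 := by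
      intro t ht
      rw [sgnSum_insert_left ha (Finset.mem_powerset.1 ht), sgnSum_insert_both ha]
      have := parallelogram_law_with_norm ℂ (sgnSum s t z) (z a)
      nlinarith
    rw [Finset.sum_congr rfl this, Finset.sum_add_distrib, ← Finset.mul_sum, ih]
    simp
    ring

theorem norm_four (S z : ℂ) : ‖S - z‖ ^ 4 + ‖S + z‖ ^ 4 ≤
    2 * ‖S‖ ^ 4 + 12 * ‖z‖ ^ 2 * ‖S‖ ^ 2 + 2 * ‖z‖ ^ 4 := by
  have e : ∀ w : ℂ, ‖w‖ ^ 4 = (w.re ^ 2 + w.im ^ 2) ^ 2 := by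
    intro w
    have := Complex.sq_norm w
    rw [Complex.normSq_apply] at this
    calc ‖w‖ ^ 4 = (‖w‖ ^ 2) ^ 2 := by ring
      _ = _ := by rw [this]; ring
  have e2 : ∀ w : ℂ, ‖w‖ ^ 2 = (w.re ^ 2 + w.im ^ 2) := by
    intro w
    have := Complex.sq_norm w
    rw [Complex.normSq_apply] at this
    rw [this]; ring
  simp only [e, e2, Complex.sub_re, Complex.sub_im, Complex.add_re, Complex.add_im]
  nlinarith [sq_nonneg (S.re * z.im - S.im * z.re)]

theorem rad_four {ι : Type*} [DecidableEq ι] (s : Finset ι) (z : ι → ℂ) :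
    ∑ t ∈ s.powerset, ‖sgnSum s t z‖ ^ 4 ≤ 2 ^ s.card * (3 * (∑ i ∈ s, ‖z i‖ ^ 2) ^ 2) := by
  induction s using Finset.induction_on with
  | empty => simp [sgnSum]
  | insert a s ha ih =>
    rw [Finset.sum_powerset_insert ha, ← Finset.sum_add_distrib, Finset.card_insert_of_notMem ha,
      Finset.sum_insert ha]
    have : ∀ t ∈ s.powerset, ‖sgnSum (insert a s) t z‖ ^ 4 + ‖sgnSum (insert a s) (insert a t) z‖ ^ 4
        ≤ 2 * ‖sgnSum s t z‖ ^ 4 + 12 * ‖z a‖ ^ 2 * ‖sgnSum s t z‖ ^ 2 + 2 * ‖z a‖ ^ 4 := by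
      intro t ht
      rw [sgnSum_insert_left ha (Finset.mem_powerset.1 ht), sgnSum_insert_both ha]
      exact norm_four _ _
    refine (Finset.sum_le_sum this).trans ?_
    rw [Finset.sum_add_distrib, Finset.sum_add_distrib, ← Finset.mul_sum, ← Finset.mul_sum, rad_two]
    simp only [Finset.sum_const, Finset.card_powerset, nsmul_eq_mul]
    push_cast
    set F := ∑ i ∈ s, ‖z i‖ ^ 2
    have h2 : (0:ℝ) < 2 ^ s.card := by positivity
    have : (0:ℝ) ≤ 2 ^ s.card * ‖z a‖ ^ 4 := by positivity
    rw [pow_succ (2:ℝ)]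
    nlinarith

theorem elem_ineq {p s : ℝ} (hp1 : 1 < p) (hp2 : p < 2) (hs : 0 ≤ s) :
    s ^ 2 - s ^ 4 / 6 ≤ s ^ p := by
  rcases le_total s 1 with h | h
  · rcases hs.eq_or_lt with h0 | h0
    · rw [← h0, Real.zero_rpow (by linarith)]; norm_num
    have : s ^ (2:ℝ) ≤ s ^ p := Real.rpow_le_rpow_of_exponent_ge h0 h hp2.le
    rw [Real.rpow_two] at this
    have : 0 ≤ s ^ 4 := by positivity
    linarith
  · have : s ^ (1:ℝ) ≤ s ^ p := Real.rpow_le_rpow_of_exponent_le h hp1.le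
    rw [Real.rpow_one] at this
    refine le_trans ?_ this
    have : s - s ^ 3 / 6 ≤ 1 := by nlinarith [mul_nonneg (by linarith : 0 ≤ s + 2.8) (sq_nonneg (s - 1.4))]
    nlinarith

theorem khin {ι : Type*} [DecidableEq ι] {p : ℝ} (hp1 : 1 < p) (hp2 : p < 2)
    (s : Finset ι) (z : ι → ℂ) :
    (∑ i ∈ s, ‖z i‖ ^ 2) ^ (p / 2) ≤ 2 * ((2 ^ s.card)⁻¹ * ∑ t ∈ s.powerset, ‖sgnSum s t z‖ ^ p) := by
  set F := ∑ i ∈ s, ‖z i‖ ^ 2 with hF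
  have hF0 : 0 ≤ F := Finset.sum_nonneg fun i _ => by positivity
  rcases hF0.eq_or_lt with h0 | h0
  · rw [← h0, Real.zero_rpow (by linarith)]
    positivity
  have hr : 0 < √F := Real.sqrt_pos.2 h0
  have hr2 : √F ^ 2 = F := Real.sq_sqrt hF0
  have hr4 : √F ^ 4 = F ^ 2 := by
    calc √F ^ 4 = (√F ^ 2) ^ 2 := by ring
      _ = F ^ 2 := by rw [hr2]
  have hFp : F ^ (p/2) = √F ^ p := by
    rw [Real.sqrt_eq_rpow, ← Real.rpow_mul hF0]; congr 1; ring
  have h1 : ∀ t ∈ s.powerset, √F ^ p * (‖sgnSum s t z‖ ^ 2 / F - ‖sgnSum s t z‖ ^ 4 / F ^ 2 / 6)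
      ≤ ‖sgnSum s t z‖ ^ p := by
    intro t _
    have := elem_ineq hp1 hp2 (div_nonneg (norm_nonneg (sgnSum s t z)) hr.le)
    rw [div_pow, div_pow, Real.div_rpow (norm_nonneg _) hr.le, hr2, hr4, le_div_iff₀ (by positivity)] at this
    linarith
  have h2 := Finset.sum_le_sum h1
  rw [← Finset.mul_sum, Finset.sum_sub_distrib, ← Finset.sum_div, ← Finset.sum_div, ← Finset.sum_div, rad_two, ← hF] at h2
  have h4 := rad_four s z
  rw [← hF] at h4
  have h2c : (0:ℝ) < 2 ^ s.card := by positivity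
  have h5 : (∑ t ∈ s.powerset, ‖sgnSum s t z‖ ^ 4) / F ^ 2 ≤ 2 ^ s.card * 3 := by
    rw [div_le_iff₀ (by positivity)]; linarith
  have h6 : 2 ^ s.card * F / F = 2 ^ s.card := by field_simp
  rw [h6] at h2
  rw [hFp]
  have h7 : √F ^ p * (2 ^ s.card / 2) ≤ ∑ t ∈ s.powerset, ‖sgnSum s t z‖ ^ p := by
    refine le_trans ?_ h2
    apply mul_le_mul_of_nonneg_left _ (by positivity)
    linarith
  calc √F ^ p = 2 * ((2 ^ s.card)⁻¹ * (√F ^ p * (2 ^ s.card / 2))) := by field_simp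
    _ ≤ _ := by gcongr

theorem J_conv {X : Type*} [MeasurableSpace X] {μ : Measure X} {w : X → ℝ≥0∞} {φ : ℝ → ℝ≥0∞}
    (hw : AEMeasurable w μ) (hφ : Continuous φ)
    (hc : ∀ s t a b : ℝ, 0 ≤ s → 0 ≤ t → 0 ≤ a → 0 ≤ b → a + b = 1 →
      φ (a * s + b * t) ≤ ENNReal.ofReal a * φ s + ENNReal.ofReal b * φ t)
    {g h : X → ℝ} (hg : AEMeasurable g μ) (hh : AEMeasurable h μ)
    (hg0 : ∀ᵐ x ∂μ, 0 ≤ g x) (hh0 : ∀ᵐ x ∂μ, 0 ≤ h x)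
    {a b : ℝ} (ha : 0 ≤ a) (hb : 0 ≤ b) (hab : a + b = 1) :
    ∫⁻ x, w x * φ (a * g x + b * h x) ∂μ ≤
      ENNReal.ofReal a * ∫⁻ x, w x * φ (g x) ∂μ + ENNReal.ofReal b * ∫⁻ x, w x * φ (h x) ∂μ := by
  have m1 : AEMeasurable (fun x => w x * φ (g x)) μ := hw.mul (hφ.measurable.comp_aemeasurable hg)
  have m2 : AEMeasurable (fun x => w x * φ (h x)) μ := hw.mul (hφ.measurable.comp_aemeasurable hh)
  rw [← lintegral_const_mul'' _ m1, ← lintegral_const_mul'' _ m2, ← lintegral_add_left' (m1.const_mul _)]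
  apply lintegral_mono_ae
  filter_upwards [hg0, hh0] with x h1 h2
  calc w x * φ (a * g x + b * h x) ≤ w x * (ENNReal.ofReal a * φ (g x) + ENNReal.ofReal b * φ (h x)) := by
        gcongr; exact hc _ _ _ _ h1 h2 ha hb hab
    _ = _ := by ring

theorem J_closed {X : Type*} [MeasurableSpace X] {μ ν : Measure X} (hac : μ ≪ ν)
    {w : X → ℝ≥0∞} {φ : ℝ → ℝ≥0∞}
    (hw : AEMeasurable w μ) (hwt : ∀ x, w x ≠ ∞) (hφ : Continuous φ) (B : ℝ≥0∞) :
    IsClosed {h : Lp ℝ 2 ν | ∫⁻ x, w x * φ (h x) ∂μ ≤ B} := by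
  apply IsSeqClosed.isClosed
  intro u h hu hlim
  obtain ⟨ns, -, hns⟩ := (tendstoInMeasure_of_tendsto_Lp hlim).exists_seq_tendsto_ae
  have hns' := hac.ae_le hns
  have m : ∀ i, AEMeasurable (fun x => w x * φ (u (ns i) x)) μ := fun i =>
    hw.mul (hφ.measurable.comp_aemeasurable (Lp.stronglyMeasurable (u (ns i))).measurable.aemeasurable)
  have key := lintegral_liminf_le' (u := Filter.atTop) m
  have e : ∫⁻ x, w x * φ (h x) ∂μ ≤ ∫⁻ x, Filter.liminf (fun i => w x * φ (u (ns i) x)) Filter.atTop ∂μ := by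
    apply lintegral_mono_ae
    filter_upwards [hns'] with x hx
    have : Filter.Tendsto (fun i => w x * φ (u (ns i) x)) Filter.atTop (nhds (w x * φ (h x))) :=
      ENNReal.Tendsto.const_mul ((hφ.tendsto _).comp hx) (Or.inr (hwt x))
    rw [this.liminf_eq]
  refine e.trans (key.trans ?_)
  refine (Filter.liminf_le_liminf (v := fun _ => B) (Filter.Eventually.of_forall fun i => hu (ns i))).trans ?_
  simp

theorem nonneg_closed {X : Type*} [MeasurableSpace X] {ν : Measure X} :
    IsClosed {h : Lp ℝ 2 ν | ∀ᵐ x ∂ν, 0 ≤ h x} := by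
  apply IsSeqClosed.isClosed
  intro u h hu hlim
  obtain ⟨ns, -, hns⟩ := (tendstoInMeasure_of_tendsto_Lp hlim).exists_seq_tendsto_ae
  have : ∀ᵐ x ∂ν, ∀ i, 0 ≤ u i x := ae_all_iff.2 hu
  show ∀ᵐ x ∂ν, 0 ≤ h x
  filter_upwards [hns, this] with x hx h2
  exact ge_of_tendsto' hx fun i => h2 _

/-- inverse square integrand -/
noncomputable def phiInv (t : ℝ) : ℝ≥0∞ := (ENNReal.ofReal t ^ 2)⁻¹
/-- power integrand -/
noncomputable def phiPow (q t : ℝ) : ℝ≥0∞ := ENNReal.ofReal t ^ q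

theorem phiInv_cont : Continuous phiInv := by
  unfold phiInv
  exact ((ENNReal.continuous_pow 2).comp ENNReal.continuous_ofReal).inv

theorem phiPow_cont {q : ℝ} : Continuous (phiPow q) := by
  unfold phiPow
  exact ENNReal.continuous_rpow_const.comp ENNReal.continuous_ofReal

theorem phiPow_conv {q : ℝ} (hq : 1 ≤ q) : ∀ s t a b : ℝ, 0 ≤ s → 0 ≤ t → 0 ≤ a → 0 ≤ b → a + b = 1 →
      phiPow q (a * s + b * t) ≤ ENNReal.ofReal a * phiPow q s + ENNReal.ofReal b * phiPow q t := by
  intro s t a b hs ht ha hb hab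
  unfold phiPow
  rw [ENNReal.ofReal_add (by positivity) (by positivity), ENNReal.ofReal_mul ha, ENNReal.ofReal_mul hb]
  apply ENNReal.rpow_arith_mean_le_arith_mean2_rpow _ _ _ _ _ hq
  rw [← ENNReal.ofReal_add ha hb, hab, ENNReal.ofReal_one]

theorem phiInv_pos {t : ℝ} (ht : 0 < t) : phiInv t = ENNReal.ofReal (t ^ 2)⁻¹ := by
  unfold phiInv
  rw [← ENNReal.ofReal_pow ht.le, ENNReal.ofReal_inv_of_pos (by positivity)]

theorem phiInv_conv : ∀ s t a b : ℝ, 0 ≤ s → 0 ≤ t → 0 ≤ a → 0 ≤ b → a + b = 1 →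
      phiInv (a * s + b * t) ≤ ENNReal.ofReal a * phiInv s + ENNReal.ofReal b * phiInv t := by
  intro s t a b hs ht ha hb hab
  rcases ha.eq_or_lt with rfl | ha'
  · have : b = 1 := by linarith
    simp [this]
  rcases hb.eq_or_lt with rfl | hb'
  · have : a = 1 := by linarith
    simp [this]
  rcases hs.eq_or_lt with rfl | hs'
  · have : phiInv 0 = ∞ := by simp [phiInv]
    rw [this, ENNReal.mul_top (by simpa using ha')]
    simp
  rcases ht.eq_or_lt with rfl | ht'
  · have : phiInv 0 = ∞ := by simp [phiInv]
    rw [this, ENNReal.mul_top (by simpa using hb')]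
    simp
  rw [phiInv_pos hs', phiInv_pos ht', phiInv_pos (by positivity), ← ENNReal.ofReal_mul ha,
    ← ENNReal.ofReal_mul hb, ← ENNReal.ofReal_add (by positivity) (by positivity)]
  apply ENNReal.ofReal_le_ofReal
  have hcv := (convexOn_zpow (𝕜 := ℝ) (-2)).2 (x := s) (y := t) hs' ht' ha hb hab
  simp only [smul_eq_mul] at hcv
  have e : ∀ x : ℝ, x ^ (-2 : ℤ) = (x ^ 2)⁻¹ := fun x => by
    rw [zpow_neg]; norm_cast
  rwa [e, e, e] at hcv

theorem minimax_fin {κ α : Type*} [Fintype κ] (G : Set α) (Q : κ → α → ℝ≥0∞)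
    (hconv : ∀ g ∈ G, ∀ h ∈ G, ∀ a b : ℝ, 0 ≤ a → 0 ≤ b → a + b = 1 →
      ∃ k ∈ G, ∀ i, Q i k ≤ ENNReal.ofReal a * Q i g + ENNReal.ofReal b * Q i h)
    (b : κ → ℝ) (hb : ∀ i, 0 ≤ b i)
    (H : ∀ c : κ → ℝ, (∀ i, 0 < c i) →
      ∃ g ∈ G, ∑ i, ENNReal.ofReal (c i) * Q i g ≤ ENNReal.ofReal (∑ i, c i * b i)) :
    ∃ g ∈ G, ∀ i, Q i g ≤ ENNReal.ofReal (b i + 1) := by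
  classical
  by_contra hcon
  push Not at hcon
  let V : Set (κ → ℝ) := {v | ∃ g ∈ G, ∀ i, 0 ≤ v i ∧ Q i g ≤ ENNReal.ofReal (v i)}
  let O : Set (κ → ℝ) := Set.univ.pi fun i => Set.Iio (b i + 1)
  have hVc : Convex ℝ V := by
    rintro v ⟨g, hg, hv⟩ w ⟨h, hh, hw⟩ x y hx hy hxy
    obtain ⟨k, hk, hkQ⟩ := hconv g hg h hh x y hx hy hxy
    refine ⟨k, hk, fun i => ?_⟩
    have h1 := (hv i).1
    have h2 := (hw i).1
    simp only [Pi.add_apply, Pi.smul_apply, smul_eq_mul]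
    refine ⟨by positivity, (hkQ i).trans ?_⟩
    rw [ENNReal.ofReal_add (by positivity) (by positivity), ENNReal.ofReal_mul hx, ENNReal.ofReal_mul hy]
    gcongr
    · exact (hv i).2
    · exact (hw i).2
  have hOc : Convex ℝ O := convex_pi fun i _ => convex_Iio _
  have hOo : IsOpen O := isOpen_set_pi Set.finite_univ fun i _ => isOpen_Iio
  have hdis : Disjoint O V := by
    rw [Set.disjoint_left]
    rintro v hvO ⟨g, hg, hv⟩
    obtain ⟨i, hi⟩ := hcon g hg
    have h1 : v i < b i + 1 := hvO i (Set.mem_univ i)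
    exact absurd ((hv i).2.trans (ENNReal.ofReal_le_ofReal h1.le)) (not_le.2 hi)
  obtain ⟨f, r, hfO, hfV⟩ := geometric_hahn_banach_open hOc hOo hVc hdis
  set c : κ → ℝ := fun i => f (Pi.single i 1) with hc
  have hf : ∀ v, f v = ∑ i, c i * v i := by
    intro v
    conv_lhs => rw [← Finset.univ_sum_single v]
    rw [map_sum]
    refine Finset.sum_congr rfl fun i _ => ?_
    have : Pi.single i (v i) = v i • (Pi.single i 1 : κ → ℝ) := by
      rw [← Pi.single_smul]; simp
    rw [this, map_smul, smul_eq_mul, mul_comm]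
  have hc0 : ∀ i, 0 ≤ c i := by
    intro i
    by_contra hneg
    push Not at hneg
    have hmem : ∀ t : ℝ, 0 ≤ t → (b - t • (Pi.single i 1 : κ → ℝ)) ∈ O := by
      intro t ht j _
      simp only [Set.mem_Iio, Pi.sub_apply, Pi.smul_apply, smul_eq_mul]
      have : 0 ≤ (Pi.single i 1 : κ → ℝ) j := by
        by_cases h : j = i
        · subst h; simp
        · simp [h]
      nlinarith
    have h1 : ∀ t : ℝ, 0 ≤ t → f b - t * c i < r := by
      intro t ht
      have := hfO _ (hmem t ht)
      rwa [map_sub, map_smul, smul_eq_mul] at this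
    have h0 := h1 0 le_rfl
    have h2 := h1 ((r - f b) / (- c i)) (div_nonneg (by linarith) (by linarith))
    have : (r - f b) / (- c i) * c i = -(r - f b) := by
      rw [div_neg, neg_mul, div_mul_cancel₀ _ hneg.ne]
    rw [this] at h2
    linarith
  -- general inequality
  have main : ∀ η : ℝ, 0 < η → r ≤ ∑ i, (c i + η) * b i := by
    intro η hη
    have hpos : ∀ i, 0 < c i + η := fun i => by linarith [hc0 i]
    obtain ⟨g, hg, hQ⟩ := H (fun i => c i + η) hpos
    have hfin : ∀ i, Q i g ≠ ∞ := by
      intro i hi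
      have : ENNReal.ofReal (c i + η) * Q i g ≤ ENNReal.ofReal (∑ i, (c i + η) * b i) :=
        (Finset.single_le_sum (f := fun i => ENNReal.ofReal (c i + η) * Q i g)
          (fun _ _ => zero_le) (Finset.mem_univ i)).trans hQ
      rw [hi, ENNReal.mul_top (by simpa using hpos i)] at this
      exact ENNReal.ofReal_ne_top (top_le_iff.1 this)
    have hv : (fun i => (Q i g).toReal) ∈ V :=
      ⟨g, hg, fun i => ⟨ENNReal.toReal_nonneg, (ENNReal.ofReal_toReal (hfin i)).ge⟩⟩
    have h1 := hfV _ hv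
    rw [hf] at h1
    have h2 : ∑ i, (c i + η) * (Q i g).toReal ≤ ∑ i, (c i + η) * b i := by
      have hs : 0 ≤ ∑ i, (c i + η) * b i := Finset.sum_nonneg fun i _ => mul_nonneg (hpos i).le (hb i)
      rw [← ENNReal.ofReal_le_ofReal_iff hs]
      rw [ENNReal.ofReal_sum_of_nonneg (fun i _ => mul_nonneg (hpos i).le ENNReal.toReal_nonneg)]
      refine le_of_eq_of_le (Finset.sum_congr rfl fun i _ => ?_) hQ
      rw [ENNReal.ofReal_mul (hpos i).le, ENNReal.ofReal_toReal (hfin i)]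
    have h3 : ∑ i, c i * (Q i g).toReal ≤ ∑ i, (c i + η) * (Q i g).toReal := by
      apply Finset.sum_le_sum
      intro i _
      have : 0 ≤ (Q i g).toReal := ENNReal.toReal_nonneg
      nlinarith
    linarith
  have hB : 0 ≤ ∑ i, b i := Finset.sum_nonneg fun i _ => hb i
  have expand : ∀ η : ℝ, ∑ i, (c i + η) * b i = f b + η * ∑ i, b i := by
    intro η
    rw [hf, Finset.mul_sum, ← Finset.sum_add_distrib]
    exact Finset.sum_congr rfl fun i _ => by ring
  -- r ≤ f b, while b ∈ O
  have hrb : r ≤ f b := by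
    apply le_of_forall_pos_le_add
    intro ε hε
    have h1 := (main (ε / (∑ i, b i + 1)) (by positivity))
    rw [expand] at h1
    have : ε / (∑ i, b i + 1) * ∑ i, b i ≤ ε := by
      rw [div_mul_eq_mul_div, div_le_iff₀ (by positivity)]
      nlinarith
    linarith
  have hbO : b ∈ O := fun i _ => by simp
  exact absurd (hfO b hbO) (not_lt.2 hrb)

theorem optimal_pt {p q : ℝ} (hqp : 0 < q) (hq : 1 / p = 1 / 2 + 1 / q)
    {P A L : ℝ≥0∞} (hP : P ≠ 0) (hP' : P ≠ ∞) (hA : A ≠ 0) (hA' : A ≠ ∞) (hL : L ≠ 0) (hL' : L ≠ ∞) :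
    P ^ (2 / p) * ((L⁻¹ * (P / A) ^ (1 / q)) ^ 2)⁻¹ = L ^ 2 * A ^ (2 / q) * P := by
  have e1 : 2 / p = 1 + 2 / q := by
    have : 2 / p = 2 * (1 / p) := by ring
    rw [this, hq]; ring
  have e2 : ((P / A) ^ (1 / q)) ^ 2 = P ^ (2 / q) * (A ^ (2 / q))⁻¹ := by
    rw [← ENNReal.rpow_natCast, ← ENNReal.rpow_mul, ENNReal.div_rpow_of_nonneg _ _ (by positivity),
      div_eq_mul_inv]
    congr 2 <;> (push_cast; ring_nf)
  have hq2 : 0 ≤ 2 / q := by positivity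
  have u0 : P ^ (2 / q) ≠ 0 := by simp [ENNReal.rpow_eq_zero_iff, hP, hP']
  have u1 : P ^ (2 / q) ≠ ∞ := ENNReal.rpow_ne_top_of_nonneg hq2 hP'
  have v0 : A ^ (2 / q) ≠ 0 := by simp [ENNReal.rpow_eq_zero_iff, hA, hA']
  have v1 : A ^ (2 / q) ≠ ∞ := ENNReal.rpow_ne_top_of_nonneg hq2 hA'
  rw [mul_pow, e2, e1, ENNReal.rpow_add _ _ hP hP', ENNReal.rpow_one]
  generalize P ^ (2 / q) = u at *
  generalize A ^ (2 / q) = v at *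
  lift P to NNReal using hP'
  lift L to NNReal using hL'
  lift u to NNReal using u1
  lift v to NNReal using v1
  norm_cast at hP hL u0 v0
  rw [← ENNReal.coe_inv hL, ← ENNReal.coe_inv v0]
  norm_cast
  rw [← ENNReal.coe_inv (by positivity)]
  norm_cast
  field_simp

theorem optimal_g {X Z : Type*} [MeasurableSpace X] {μ : Measure X} [Countable Z] [MeasurableSpace Z]
    [MeasurableSingletonClass Z] {cell : X → Z} (hcell : Measurable cell)
    {p q : ℝ} (hp1 : 1 < p) (hqp : 0 < q) (hq : 1 / p = 1 / 2 + 1 / q)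
    {lam : Z → ℝ} (hlam : ∀ a, 0 < lam a) {F : X → ℝ≥0∞} (hF : AEMeasurable F μ) (hFt : ∀ x, F x ≠ ∞)
    (hD : ∑' a, ENNReal.ofReal (lam a) ^ 2 * (∫⁻ x in cell ⁻¹' {a}, F x ^ (p / 2) ∂μ) ^ (2 / p) ≠ ∞) :
    ∃ g : X → ℝ, AEMeasurable g μ ∧ (∀ᵐ x ∂μ, 0 ≤ g x) ∧
      (∀ a, ∫⁻ x in cell ⁻¹' {a}, phiPow q (g x) ∂μ ≤ (ENNReal.ofReal (lam a))⁻¹ ^ q) ∧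
      ∫⁻ x, F x * phiInv (g x) ∂μ ≤
        ∑' a, ENNReal.ofReal (lam a) ^ 2 * (∫⁻ x in cell ⁻¹' {a}, F x ^ (p / 2) ∂μ) ^ (2 / p) := by
  have hp0 : 0 < p := by linarith
  set A : Z → ℝ≥0∞ := fun a => ∫⁻ x in cell ⁻¹' {a}, F x ^ (p / 2) ∂μ with hAdef
  set L : Z → ℝ≥0∞ := fun a => ENNReal.ofReal (lam a) with hLdef
  have hL0 : ∀ a, L a ≠ 0 := fun a => by simpa [hLdef] using hlam a
  have hLt : ∀ a, L a ≠ ∞ := fun a => ENNReal.ofReal_ne_top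
  have hAt : ∀ a, A a ≠ ∞ := by
    intro a ha
    apply ENNReal.ne_top_of_tsum_ne_top hD a
    change L a ^ 2 * A a ^ (2 / p) = ∞
    rw [ha, ENNReal.top_rpow_of_pos (by positivity), ENNReal.mul_top (pow_ne_zero _ (hL0 a))]
  have hPm : AEMeasurable (fun x => F x ^ (p / 2)) μ := hF.pow_const _
  have hPt : ∀ x, F x ^ (p / 2) ≠ ∞ := fun x => ENNReal.rpow_ne_top_of_nonneg (by positivity) (hFt x)
  have hKm : ∀ a, MeasurableSet (cell ⁻¹' {a}) := fun a => hcell (measurableSet_singleton a)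
  have hmZ : ∀ φ : Z → ℝ≥0∞, Measurable fun x => φ (cell x) := fun φ =>
    (measurable_of_countable φ).comp hcell
  set gE : X → ℝ≥0∞ := fun x => (L (cell x))⁻¹ * (F x ^ (p / 2) / A (cell x)) ^ (1 / q) with hgE
  have hgEm : AEMeasurable gE μ :=
    (hmZ (fun a => (L a)⁻¹)).aemeasurable.mul ((hPm.div (hmZ A).aemeasurable).pow_const _)
  have hz : ∀ᵐ x ∂μ, A (cell x) = 0 → F x = 0 := by
    have : ∀ a, ∀ᵐ x ∂μ, x ∈ cell ⁻¹' {a} → A a = 0 → F x = 0 := by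
      intro a
      by_cases ha : A a = 0
      · have h1 := (lintegral_eq_zero_iff' hPm.restrict).1 ha
        have h2 := (ae_restrict_iff' (hKm a)).1 h1
        filter_upwards [h2] with x hx hxa _
        have := hx hxa
        simp only [Pi.zero_apply, ENNReal.rpow_eq_zero_iff] at this
        rcases this with h | h
        · exact h.1
        · linarith [h.2]
      · exact Filter.Eventually.of_forall fun x _ h => absurd h ha
    filter_upwards [ae_all_iff.2 this] with x hx h0
    exact hx (cell x) rfl h0
  have hgt : ∀ᵐ x ∂μ, gE x ≠ ∞ := by
    filter_upwards [hz] with x hx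
    simp only [hgE]
    apply ENNReal.mul_ne_top (ENNReal.inv_ne_top.2 (hL0 _))
    apply ENNReal.rpow_ne_top_of_nonneg (by positivity)
    by_cases h : A (cell x) = 0
    · rw [hx h, h, ENNReal.zero_rpow_of_pos (by positivity)]; simp
    · exact ENNReal.div_ne_top (hPt x) h
  have hof : ∀ᵐ x ∂μ, ENNReal.ofReal ((gE x).toReal) = gE x := by
    filter_upwards [hgt] with x hx using ENNReal.ofReal_toReal hx
  refine ⟨fun x => (gE x).toReal, hgEm.ennreal_toReal, Filter.Eventually.of_forall fun x => ENNReal.toReal_nonneg, ?_, ?_⟩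
  · intro a
    have e : ∫⁻ x in cell ⁻¹' {a}, phiPow q ((gE x).toReal) ∂μ
        = ∫⁻ x in cell ⁻¹' {a}, ((L a)⁻¹ ^ q * (A a)⁻¹) * F x ^ (p / 2) ∂μ := by
      apply lintegral_congr_ae
      rw [Filter.EventuallyEq, ae_restrict_iff' (hKm a)]
      filter_upwards [hof] with x hx hxa
      have hxa' : cell x = a := hxa
      rw [phiPow, hx]
      simp only [hgE, hxa']
      rw [ENNReal.mul_rpow_of_nonneg _ _ hqp.le, ← ENNReal.rpow_mul, one_div_mul_cancel hqp.ne', ENNReal.rpow_one,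
        div_eq_mul_inv]
      ring
    rw [e, lintegral_const_mul'' _ hPm.restrict, mul_assoc]
    calc (L a)⁻¹ ^ q * ((A a)⁻¹ * A a) ≤ (L a)⁻¹ ^ q * 1 := by
          gcongr
          exact ENNReal.inv_mul_le_one _
      _ = _ := mul_one _
  · have hU : (⋃ a, cell ⁻¹' {a}) = Set.univ := by ext x; simp
    have hdisj : Pairwise (Function.onFun Disjoint fun a => cell ⁻¹' {a}) := by
      intro a b hab
      exact Disjoint.preimage _ (by simpa using hab)
    rw [← setLIntegral_univ, ← hU, lintegral_iUnion hKm hdisj]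
    apply ENNReal.tsum_le_tsum
    intro a
    have e : ∫⁻ x in cell ⁻¹' {a}, F x * phiInv ((gE x).toReal) ∂μ
        ≤ ∫⁻ x in cell ⁻¹' {a}, (L a ^ 2 * A a ^ (2 / q)) * F x ^ (p / 2) ∂μ := by
      apply lintegral_mono_ae
      rw [ae_restrict_iff' (hKm a)]
      filter_upwards [hof, hz] with x hx hx0 hxa
      have hxa' : cell x = a := hxa
      rw [phiInv, hx]
      by_cases hF0 : F x = 0
      · rw [hF0, zero_mul]; exact zero_le
      have hA0 : A a ≠ 0 := fun h => hF0 (hx0 (by rw [hxa', h]))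
      have hP0 : F x ^ (p / 2) ≠ 0 := by simp [ENNReal.rpow_eq_zero_iff, hF0, hFt x]
      have := optimal_pt hqp hq hP0 (hPt x) hA0 (hAt a) (hL0 a) (hLt a)
      rw [← ENNReal.rpow_mul, show p / 2 * (2 / p) = 1 by field_simp, ENNReal.rpow_one] at this
      simp only [hgE, hxa']
      exact this.le
    refine e.trans ?_
    rw [lintegral_const_mul'' _ hPm.restrict]
    change L a ^ 2 * A a ^ (2 / q) * A a ≤ L a ^ 2 * A a ^ (2 / p)
    rw [mul_assoc]
    gcongr
    by_cases hA0 : A a = 0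
    · rw [hA0, mul_zero]; exact zero_le
    have e1 : 2 / p = 2 / q + 1 := by
      have : 2 / p = 2 * (1 / p) := by ring
      rw [this, hq]; ring
    rw [e1, ENNReal.rpow_add _ _ hA0 (hAt a), ENNReal.rpow_one]

theorem ind_lint {X : Type*} [MeasurableSpace X] {μ : Measure X} {K : Set X} (hK : MeasurableSet K)
    (φ : X → ℝ≥0∞) : ∫⁻ x, K.indicator 1 x * φ x ∂μ = ∫⁻ x in K, φ x ∂μ := by
  rw [← lintegral_indicator hK]
  congr 1
  ext x
  by_cases h : x ∈ K <;> simp [h]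

theorem sq_le_one_add {q : ℝ} (hq : 2 ≤ q) (t : ℝ≥0∞) : t ^ (2:ℝ) ≤ 1 + t ^ q := by
  rcases le_total t 1 with h | h
  · exact (ENNReal.rpow_le_one h (by norm_num)).trans le_self_add
  · exact (ENNReal.rpow_le_rpow_of_exponent_le h hq).trans le_add_self

theorem abstract_g {X Z : Type*} [MeasurableSpace X] {μ : Measure X} [Countable Z] [MeasurableSpace Z]
    [MeasurableSingletonClass Z] {cell : X → Z} (hcell : Measurable cell)
    (hfin : ∀ a, μ (cell ⁻¹' {a}) ≠ ∞)
    {p q : ℝ} (hp1 : 1 < p) (hq2 : 2 ≤ q) (hq : 1 / p = 1 / 2 + 1 / q)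
    {lam : Z → ℝ} (hlam : ∀ a, 0 < lam a) {ι : Type*} {f : ι → X → ℂ}
    (hf : ∀ i, AEStronglyMeasurable (f i) μ) {b : ι → ℝ} (hb : ∀ i, 0 ≤ b i)
    (H : ∀ (S : Finset ι) (c : ι → ℝ), (∀ i, 0 ≤ c i) →
      ∑' a, ENNReal.ofReal (lam a) ^ 2 * (∫⁻ x in cell ⁻¹' {a},
        (∑ i ∈ S, ENNReal.ofReal (c i) * ‖f i x‖ₑ ^ 2) ^ (p / 2) ∂μ) ^ (2 / p)
        ≤ ENNReal.ofReal (∑ i ∈ S, c i * b i)) :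
    ∃ g : X → ℝ, Measurable g ∧ (∀ᵐ x ∂μ, 0 ≤ g x) ∧
      (∀ a, ∫⁻ x in cell ⁻¹' {a}, phiPow q (g x) ∂μ ≤ (ENNReal.ofReal (lam a))⁻¹ ^ q) ∧
      ∀ i, ∫⁻ x, ‖f i x‖ₑ ^ 2 * phiInv (g x) ∂μ ≤ ENNReal.ofReal (b i + 1) := by
  classical
  have hq0 : 0 < q := by linarith
  have hKm : ∀ a, MeasurableSet (cell ⁻¹' {a}) := fun a => hcell (measurableSet_singleton a)
  set M : Z → ℝ≥0∞ := fun a => (ENNReal.ofReal (lam a))⁻¹ ^ q with hM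
  have hMt : ∀ a, M a ≠ ∞ := fun a =>
    ENNReal.rpow_ne_top_of_nonneg hq0.le (ENNReal.inv_ne_top.2 (by simpa using hlam a))
  have hfm : ∀ i, AEMeasurable (fun x => ‖f i x‖ₑ ^ 2) μ := fun i => (hf i).enorm.pow_const 2
  have hft : ∀ i x, ‖f i x‖ₑ ^ 2 ≠ ∞ := fun i x => ENNReal.pow_ne_top enorm_ne_top
  have hIm : ∀ a, AEMeasurable (fun x => (cell ⁻¹' {a}).indicator (1 : X → ℝ≥0∞) x) μ := fun a =>
    (measurable_one.indicator (hKm a)).aemeasurable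
  -- the admissible functions
  let G : Set (X → ℝ) := {g | AEMeasurable g μ ∧ (∀ᵐ x ∂μ, 0 ≤ g x) ∧
    ∀ a, ∫⁻ x, (cell ⁻¹' {a}).indicator 1 x * phiPow q (g x) ∂μ ≤ M a}
  have combo : ∀ (a b : ℝ) (B : ℝ≥0∞), 0 ≤ a → 0 ≤ b → a + b = 1 →
      ENNReal.ofReal a * B + ENNReal.ofReal b * B = B := by
    intro a b B ha hb hab
    rw [← add_mul, ← ENNReal.ofReal_add ha hb, hab, ENNReal.ofReal_one, one_mul]
  have hGconv : ∀ g ∈ G, ∀ h ∈ G, ∀ a b : ℝ, 0 ≤ a → 0 ≤ b → a + b = 1 →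
      (fun x => a * g x + b * h x) ∈ G := by
    rintro g ⟨g1, g2, g3⟩ h ⟨h1, h2, h3⟩ a b ha hb hab
    refine ⟨(g1.const_mul a).add (h1.const_mul b), ?_, fun z => ?_⟩
    · filter_upwards [g2, h2] with x hx hy
      positivity
    · refine (J_conv (hIm z) phiPow_cont (phiPow_conv (by linarith)) g1 h1 g2 h2 ha hb hab).trans ?_
      rw [← combo a b (M z) ha hb hab]
      gcongr
      · exact g3 z
      · exact h3 z
  have finite : ∀ S : Finset ι, ∃ g ∈ G, ∀ i : S,
      ∫⁻ x, ‖f i x‖ₑ ^ 2 * phiInv (g x) ∂μ ≤ ENNReal.ofReal (b i + 1) := by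
    intro S
    apply minimax_fin G (fun (i : S) g => ∫⁻ x, ‖f i x‖ₑ ^ 2 * phiInv (g x) ∂μ) _ (fun i : S => b i)
      (fun i => hb i)
    · intro c hc
      let c' : ι → ℝ := fun i => if h : i ∈ S then c ⟨i, h⟩ else 0
      have hc'0 : ∀ i, 0 ≤ c' i := by
        intro i
        by_cases h : i ∈ S
        · simp only [c', h, dif_pos]; exact (hc _).le
        · simp [c', h]
      have hc' : ∀ i : S, c' i = c i := fun i => by simp [c']
      have hH := H S c' hc'0
      obtain ⟨g, g1, g2, g3, g4⟩ := optimal_g hcell hp1 hq0 hq hlam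
        (F := fun x => ∑ i ∈ S, ENNReal.ofReal (c' i) * ‖f i x‖ₑ ^ 2)
        (Finset.aemeasurable_fun_sum _ fun i _ => (hfm i).const_mul _)
        (fun x => by
          refine (ENNReal.sum_lt_top.2 fun i _ => ?_).ne
          exact ENNReal.mul_lt_top ENNReal.ofReal_lt_top (hft i x).lt_top)
        (ne_top_of_le_ne_top ENNReal.ofReal_ne_top hH)
      refine ⟨g, ⟨g1, g2, fun a => ?_⟩, ?_⟩
      · rw [ind_lint (hKm a)]; exact g3 a
      · have h5 := g4.trans hH
        simp only [Finset.sum_mul] at h5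
        have hm : AEMeasurable (fun x => phiInv (g x)) μ := phiInv_cont.measurable.comp_aemeasurable g1
        have hmm : ∀ i ∈ S, AEMeasurable
            (fun x => ENNReal.ofReal (c' i) * ‖f i x‖ₑ ^ 2 * phiInv (g x)) μ :=
          fun i _ => ((hfm i).const_mul _).mul hm
        rw [lintegral_finsetSum' _ hmm] at h5
        simp only [mul_assoc] at h5
        simp_rw [lintegral_const_mul' _ _ ENNReal.ofReal_ne_top] at h5
        rw [← Finset.sum_coe_sort S, ← Finset.sum_coe_sort S] at h5
        simpa only [hc'] using h5
    · intro g hg h hh x y hx hy hxy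
      exact ⟨_, hGconv g hg h hh x y hx hy hxy, fun i =>
        J_conv (hfm i) phiInv_cont phiInv_conv hg.1 hh.1 hg.2.1 hh.2.1 hx hy hxy⟩
  -- the weighted measure
  obtain ⟨ε, hε0, hε1⟩ := ENNReal.exists_pos_sum_of_countable' (ε := 1) one_ne_zero Z
  set B : Z → ℝ≥0∞ := fun a => μ (cell ⁻¹' {a}) + M a with hB
  have hBt : ∀ a, B a ≠ ∞ := fun a => ENNReal.add_ne_top.2 ⟨hfin a, hMt a⟩
  set w : Z → ℝ≥0∞ := fun a => ε a / (B a + 1) with hw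
  have hw0 : ∀ a, w a ≠ 0 := fun a => by
    simp only [hw]
    exact ENNReal.div_ne_zero.2 ⟨(hε0 a).ne', ENNReal.add_ne_top.2 ⟨hBt a, ENNReal.one_ne_top⟩⟩
  have hwB : ∀ a, w a * B a ≤ ε a := by
    intro a
    calc w a * B a ≤ ε a / (B a + 1) * (B a + 1) := by gcongr; exact le_self_add
      _ = ε a := ENNReal.div_mul_cancel (by simp)
          (ENNReal.add_ne_top.2 ⟨hBt a, ENNReal.one_ne_top⟩)
  set ν : Measure X := Measure.sum fun a => w a • μ.restrict (cell ⁻¹' {a}) with hν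
  have hνμ : ν ≪ μ := by
    apply Measure.absolutelyContinuous_sum_left
    intro a
    exact (Measure.absolutelyContinuous_of_le Measure.restrict_le_self).smul_left _
  have hμν : μ ≪ ν := by
    apply Measure.AbsolutelyContinuous.mk
    intro s hs h0
    rw [hν, Measure.sum_apply _ hs, ENNReal.tsum_eq_zero] at h0
    have : s = ⋃ a, s ∩ cell ⁻¹' {a} := by ext x; simp
    rw [this, measure_iUnion_null_iff]
    intro a
    have := h0 a
    rw [Measure.smul_apply, smul_eq_mul, mul_eq_zero, Measure.restrict_apply hs] at this
    exact this.resolve_left (hw0 a)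
  have hnorm : ∀ g ∈ G, eLpNorm g 2 ν ≤ 1 := by
    rintro g ⟨g1, g2, g3⟩
    rw [eLpNorm_eq_lintegral_rpow_enorm_toReal (by norm_num) (by norm_num)]
    apply ENNReal.rpow_le_one _ (by positivity)
    rw [hν, lintegral_sum_measure]
    refine le_trans (ENNReal.tsum_le_tsum fun a => ?_) hε1.le
    rw [lintegral_smul_measure, smul_eq_mul]
    refine le_trans ?_ (hwB a)
    gcongr
    have h3 := g3 a
    rw [ind_lint (hKm a)] at h3
    calc ∫⁻ x in cell ⁻¹' {a}, ‖g x‖ₑ ^ (2 : ℝ≥0∞).toReal ∂μ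
        ≤ ∫⁻ x in cell ⁻¹' {a}, (1 + phiPow q (g x)) ∂μ := by
          apply lintegral_mono_ae
          filter_upwards [ae_restrict_of_ae g2] with x hx
          rw [phiPow, Real.enorm_of_nonneg hx]
          exact sq_le_one_add hq2 _
      _ = μ (cell ⁻¹' {a}) + ∫⁻ x in cell ⁻¹' {a}, phiPow q (g x) ∂μ := by
          rw [lintegral_add_left measurable_const]; simp
      _ ≤ B a := by
          simp only [hB]; gcongr
  let C : Finset ι → Set (Lp ℝ 2 ν) := fun S => {h | (∀ᵐ x ∂ν, 0 ≤ h x) ∧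
    (∀ a, ∫⁻ x, (cell ⁻¹' {a}).indicator 1 x * phiPow q (h x) ∂μ ≤ M a) ∧
    ∀ i ∈ S, ∫⁻ x, ‖f i x‖ₑ ^ 2 * phiInv (h x) ∂μ ≤ ENNReal.ofReal (b i + 1)}
  have hCG : ∀ S, ∀ h ∈ C S, (h : X → ℝ) ∈ G := fun S h hh =>
    ⟨(Lp.stronglyMeasurable h).measurable.aemeasurable, hμν.ae_le hh.1, hh.2.1⟩
  obtain ⟨h, hh⟩ := directed_inter C
    (by
      intro S S' hS h hh
      exact ⟨hh.1, hh.2.1, fun i hi => hh.2.2 i (hS hi)⟩)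
    (by
      intro S
      obtain ⟨g, hg, hgS⟩ := finite S
      have hmem : MemLp g 2 ν :=
        ⟨(hg.1.mono_ac hνμ).aestronglyMeasurable, (hnorm g hg).trans_lt ENNReal.one_lt_top⟩
      have hae : hmem.toLp g =ᵐ[ν] g := hmem.coeFn_toLp
      have hae' : hmem.toLp g =ᵐ[μ] g := hμν.ae_le hae
      refine ⟨hmem.toLp g, ?_, fun a => ?_, fun i hi => ?_⟩
      · filter_upwards [hae, hνμ.ae_le hg.2.1] with x hx hx0
        rw [hx]; exact hx0
      · refine le_of_eq_of_le (lintegral_congr_ae ?_) (hg.2.2 a)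
        filter_upwards [hae'] with x hx
        rw [hx]
      · refine le_of_eq_of_le (lintegral_congr_ae ?_) (hgS ⟨i, hi⟩)
        filter_upwards [hae'] with x hx
        rw [hx])
    (by
      intro S
      have : C S = {h : Lp ℝ 2 ν | ∀ᵐ x ∂ν, 0 ≤ h x} ∩
          ((⋂ a, {h : Lp ℝ 2 ν | ∫⁻ x, (cell ⁻¹' {a}).indicator 1 x * phiPow q (h x) ∂μ ≤ M a}) ∩
          ⋂ i ∈ S, {h : Lp ℝ 2 ν | ∫⁻ x, ‖f i x‖ₑ ^ 2 * phiInv (h x) ∂μ ≤ ENNReal.ofReal (b i + 1)}) := by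
        ext h; simp [C]
      rw [this]
      refine nonneg_closed.inter ((isClosed_iInter fun a => ?_).inter
        (isClosed_biInter fun i _ => ?_))
      · exact J_closed hμν (hIm a) (fun x => by by_cases hx : x ∈ cell ⁻¹' {a} <;> simp [Set.indicator, hx]) phiPow_cont _
      · exact J_closed hμν (hfm i) (hft i) phiInv_cont _)
    (by
      intro S g hg h hh x y hx hy hxy
      have hg' := hCG S g hg
      have hh' := hCG S h hh
      have hc := hGconv _ hg' _ hh' x y hx hy hxy
      have hae : (x • g + y • h : Lp ℝ 2 ν) =ᵐ[ν] fun t => x * g t + y * h t := by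
        filter_upwards [Lp.coeFn_add (x • g) (y • h), Lp.coeFn_smul x g, Lp.coeFn_smul y h] with t h1 h2 h3
        rw [h1, Pi.add_apply, h2, h3]; simp
      have hae' := hμν.ae_le hae
      refine ⟨?_, fun a => ?_, fun i hi => ?_⟩
      · filter_upwards [hae, hνμ.ae_le hc.2.1] with t ht ht0
        rw [ht]; exact ht0
      · refine le_of_eq_of_le (lintegral_congr_ae ?_) (hc.2.2 a)
        filter_upwards [hae'] with t ht
        rw [ht]
      · refine le_trans (le_of_eq (lintegral_congr_ae ?_)) ((J_conv (hfm i) phiInv_cont phiInv_conv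
          hg'.1 hh'.1 hg'.2.1 hh'.2.1 hx hy hxy).trans ?_)
        · filter_upwards [hae'] with t ht
          rw [ht]
        · rw [← combo x y (ENNReal.ofReal (b i + 1)) hx hy hxy]
          gcongr
          · exact hg.2.2 i hi
          · exact hh.2.2 i hi)
    1
    (by
      intro S g hg
      have := hnorm _ (hCG S g hg)
      rw [Lp.norm_def]
      exact ENNReal.toReal_le_of_le_ofReal zero_le_one (by simpa using this))
  refine ⟨h, (Lp.stronglyMeasurable h).measurable, hμν.ae_le (hh ∅).1, fun a => ?_, fun i => ?_⟩
  · have := (hh ∅).2.1 a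
    rwa [ind_lint (hKm a)] at this
  · exact (hh {i}).2.2 i (by simp)
/-- index of the cube containing a point -/
def cellOf {n : ℕ} (x : Fin n → ℝ) : Fin n → ℤ := fun i => ⌈x i - 1 / 2⌉

theorem cellOf_meas {n : ℕ} : Measurable (cellOf (n := n)) := by
  unfold cellOf
  rw [measurable_pi_iff]
  intro i
  exact Int.measurable_ceil.comp ((measurable_pi_apply i).sub_const _)

theorem cube_eq {n : ℕ} (a : Fin n → ℤ) : cube a = cellOf ⁻¹' {a} := by
  ext x
  simp only [cube, cellOf, Set.mem_ofPred_eq, Set.mem_preimage, Set.mem_singleton_iff, funext_iff,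
    Int.ceil_eq_iff]
  refine forall_congr' fun i => ?_
  constructor <;> rintro ⟨h1, h2⟩ <;> constructor <;> linarith

theorem cube_fin {n : ℕ} (a : Fin n → ℤ) : volume (cube a) ≠ ∞ := by
  have : cube a ⊆ Set.Icc (fun i => (a i : ℝ) - 1 / 2) (fun i => (a i : ℝ) + 1 / 2) := by
    intro x hx
    exact ⟨fun i => (hx i).1.le, fun i => (hx i).2⟩
  exact ((measure_mono this).trans_lt isCompact_Icc.measure_lt_top).ne

theorem pieceNorm_eq {n : ℕ} {F : Type*} [NormedAddCommGroup F] {p : ℝ} (hp : 0 < p)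
    (f : (Fin n → ℝ) → F) (a : Fin n → ℤ) :
    pieceNorm p f a = (∫⁻ x in cellOf ⁻¹' {a}, ‖f x‖ₑ ^ p) ^ (1 / p) := by
  unfold pieceNorm
  rw [cube_eq, eLpNorm_indicator_eq_eLpNorm_restrict (cellOf_meas (measurableSet_singleton a)),
    eLpNorm_eq_lintegral_rpow_enorm_toReal (by simpa using hp) ENNReal.ofReal_ne_top,
    ENNReal.toReal_ofReal hp.le]

theorem khin_enn {ι : Type*} [DecidableEq ι] {p : ℝ} (hp1 : 1 < p) (hp2 : p < 2)
    (s : Finset ι) (z : ι → ℂ) :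
    (∑ i ∈ s, ‖z i‖ₑ ^ 2) ^ (p / 2) ≤
      ∑ t ∈ s.powerset, ((2 : ℝ≥0∞) ^ s.card)⁻¹ * (2 * ‖sgnSum s t z‖ₑ ^ p) := by
  have h := ENNReal.ofReal_le_ofReal (khin hp1 hp2 s z)
  have h0 : 0 ≤ ∑ i ∈ s, ‖z i‖ ^ 2 := Finset.sum_nonneg fun i _ => by positivity
  rw [← ENNReal.ofReal_rpow_of_nonneg h0 (by linarith),
    ENNReal.ofReal_sum_of_nonneg (fun i _ => by positivity), ENNReal.ofReal_mul (by norm_num),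
    ENNReal.ofReal_mul (by positivity), ENNReal.ofReal_sum_of_nonneg (fun i _ => by positivity),
    ENNReal.ofReal_inv_of_pos (by positivity), ENNReal.ofReal_pow (by norm_num)] at h
  simp only [ENNReal.ofReal_ofNat, ENNReal.ofReal_pow (norm_nonneg _), ofReal_norm,
    ← ENNReal.ofReal_rpow_of_nonneg (norm_nonneg _) (by linarith : 0 ≤ p)] at h
  refine h.trans (le_of_eq ?_)
  rw [Finset.mul_sum, Finset.mul_sum]
  exact Finset.sum_congr rfl fun t _ => by ring

theorem khin_bound {X Z 𝓗 : Type*} [MeasurableSpace X] {μ : Measure X} [NormedAddCommGroup 𝓗]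
    [InnerProductSpace ℂ 𝓗] {K : Z → Set X} {p : ℝ} (hp1 : 1 < p) (hp2 : p < 2)
    (L : Z → ℝ≥0∞) (T : 𝓗 →ₗ[ℂ] (X → ℂ)) (hT : ∀ u, AEStronglyMeasurable (T u) μ) (C : ℝ)
    (hb : ∀ u, ∑' a, L a ^ 2 * (∫⁻ x in K a, ‖T u x‖ₑ ^ p ∂μ) ^ (2 / p) ≤
      ENNReal.ofReal (C ^ 2 * ‖u‖ ^ 2))
    (S : Finset 𝓗) (c : 𝓗 → ℝ) (hc : ∀ u, 0 ≤ c u) :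
    ∑' a, L a ^ 2 * (∫⁻ x in K a,
        (∑ u ∈ S, ENNReal.ofReal (c u) * ‖T u x‖ₑ ^ 2) ^ (p / 2) ∂μ) ^ (2 / p)
        ≤ ENNReal.ofReal (∑ u ∈ S, c u * (4 * C ^ 2 * ‖u‖ ^ 2)) := by
  classical
  have hp0 : 0 < p := by linarith
  let w : 𝓗 → 𝓗 := fun u => ((√(c u) : ℝ) : ℂ) • u
  have hw : ∀ u, ‖w u‖ ^ 2 = c u * ‖u‖ ^ 2 := by
    intro u
    simp only [w, norm_smul, mul_pow, Complex.norm_real, Real.norm_eq_abs, sq_abs, Real.sq_sqrt (hc u)]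
  have hwT : ∀ u x, ENNReal.ofReal (c u) * ‖T u x‖ₑ ^ 2 = ‖T (w u) x‖ₑ ^ 2 := by
    intro u x
    simp only [w, map_smul, Pi.smul_apply, smul_eq_mul]
    rw [← ofReal_norm, ← ofReal_norm, ← ENNReal.ofReal_pow (norm_nonneg _),
      ← ENNReal.ofReal_pow (norm_nonneg _), ← ENNReal.ofReal_mul (hc u)]
    simp only [norm_mul, mul_pow, Complex.norm_real, Real.norm_eq_abs, sq_abs, Real.sq_sqrt (hc u)]
  have hsg : ∀ t x, sgnSum S t (fun u => T (w u) x) = T (sgnSum S t w) x := by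
    intro t x
    unfold sgnSum
    rw [map_sum, Finset.sum_apply]
    refine Finset.sum_congr rfl fun u _ => ?_
    split_ifs <;> simp
  simp only [hwT]
  set W : ℝ≥0∞ := ((2 : ℝ≥0∞) ^ S.card)⁻¹ with hW
  have hWt : W ≠ ∞ := by simp [hW]
  have hW1 : ∑ t ∈ S.powerset, W = 1 := by
    rw [Finset.sum_const, Finset.card_powerset, nsmul_eq_mul, hW]
    push_cast
    exact ENNReal.mul_inv_cancel (by simp) (by simp)
  have hA : ∀ a, (∫⁻ x in K a, (∑ u ∈ S, ‖T (w u) x‖ₑ ^ 2) ^ (p / 2) ∂μ) ^ (2 / p) ≤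
      ∑ t ∈ S.powerset, W * (4 * (∫⁻ x in K a, ‖T (sgnSum S t w) x‖ₑ ^ p ∂μ) ^ (2 / p)) := by
    intro a
    have h1 : ∫⁻ x in K a, (∑ u ∈ S, ‖T (w u) x‖ₑ ^ 2) ^ (p / 2) ∂μ ≤
        ∑ t ∈ S.powerset, W * (2 * ∫⁻ x in K a, ‖T (sgnSum S t w) x‖ₑ ^ p ∂μ) := by
      have hm : ∀ t ∈ S.powerset, AEMeasurable (fun x => W * (2 * ‖T (sgnSum S t w) x‖ₑ ^ p))
          (μ.restrict (K a)) := fun t _ =>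
        ((((hT _).enorm.pow_const _).const_mul _).const_mul _).restrict
      calc _ ≤ ∫⁻ x in K a, ∑ t ∈ S.powerset, W * (2 * ‖T (sgnSum S t w) x‖ₑ ^ p) ∂μ := by
            apply lintegral_mono
            intro x
            have := khin_enn hp1 hp2 S (fun u => T (w u) x)
            simpa only [hsg] using this
        _ = _ := by
            rw [lintegral_finsetSum' _ hm]
            refine Finset.sum_congr rfl fun t _ => ?_
            rw [lintegral_const_mul' _ _ hWt, lintegral_const_mul' _ _ (by norm_num)]
    have h2p : 1 ≤ 2 / p := by rw [le_div_iff₀ hp0]; linarith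
    refine (ENNReal.rpow_le_rpow h1 (by positivity)).trans
      ((ENNReal.rpow_arith_mean_le_arith_mean_rpow _ _ _ hW1 h2p).trans ?_)
    apply Finset.sum_le_sum
    intro t _
    rw [ENNReal.mul_rpow_of_nonneg _ _ (by positivity)]
    gcongr
    calc (2 : ℝ≥0∞) ^ (2 / p) ≤ 2 ^ (2 : ℝ) := by
          apply ENNReal.rpow_le_rpow_of_exponent_le (by norm_num)
          rw [div_le_iff₀ hp0]; linarith
      _ = 4 := by rw [ENNReal.rpow_two]; norm_num
  calc _ ≤ ∑' a, ∑ t ∈ S.powerset,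
        W * (4 * (L a ^ 2 * (∫⁻ x in K a, ‖T (sgnSum S t w) x‖ₑ ^ p ∂μ) ^ (2 / p))) := by
        apply ENNReal.tsum_le_tsum
        intro a
        calc _ ≤ L a ^ 2 * _ := mul_le_mul_right (hA a) _
          _ = _ := by
            rw [Finset.mul_sum]
            exact Finset.sum_congr rfl fun t _ => by ring
    _ = ∑ t ∈ S.powerset, W * (4 * ∑' a, (L a ^ 2 *
          (∫⁻ x in K a, ‖T (sgnSum S t w) x‖ₑ ^ p ∂μ) ^ (2 / p))) := by
        rw [Summable.tsum_finsetSum fun _ _ => ENNReal.summable]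
        simp only [ENNReal.tsum_mul_left]
    _ ≤ ∑ t ∈ S.powerset, W * (4 * ENNReal.ofReal (C ^ 2 * ‖sgnSum S t w‖ ^ 2)) := by
        gcongr with t _
        exact hb _
    _ = W * (4 * ENNReal.ofReal (C ^ 2 * ∑ t ∈ S.powerset, ‖sgnSum S t w‖ ^ 2)) := by
        rw [← Finset.mul_sum, ← Finset.mul_sum, ← ENNReal.ofReal_sum_of_nonneg (fun i _ => by positivity),
          Finset.mul_sum]
    _ = _ := by
        rw [rad_two]
        simp only [hw]
        have hWr : W = ENNReal.ofReal ((2 ^ S.card : ℝ)⁻¹) := by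
          rw [ENNReal.ofReal_inv_of_pos (by positivity), ENNReal.ofReal_pow (by norm_num), hW]
          simp
        have h4 : (4 : ℝ≥0∞) = ENNReal.ofReal 4 := by simp
        rw [hWr, h4, ← ENNReal.ofReal_mul (by norm_num), ← ENNReal.ofReal_mul (by positivity)]
        congr 1
        have : ∑ u ∈ S, c u * (4 * C ^ 2 * ‖u‖ ^ 2) = 4 * C ^ 2 * ∑ u ∈ S, c u * ‖u‖ ^ 2 := by
          rw [Finset.mul_sum]
          exact Finset.sum_congr rfl fun t _ => by ring
        rw [this]
        field_simp

/-- (Maurey-type factorization.)  Every bounded linear operator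
`T : 𝓗 → 𝓛 = ℓ²_λ(L^p)` from a Hilbert space factorizes as `T = g(Q) R` with
`R : 𝓗 → L²(ℝⁿ)` bounded and `0 ≤ g ∈ 𝓜 = ℓ^∞_λ(L^q)`. -/
theorem stmt18 {n : ℕ} (hn : 0 < n) (p q : ℝ) (hp1 : 1 < p) (hp2 : p < 2)
    (hq : 1 / p = 1 / 2 + 1 / q)
    (lam : (Fin n → ℤ) → ℝ) (hlam : ∀ a, 0 < lam a)
    {𝓗 : Type*} [NormedAddCommGroup 𝓗] [InnerProductSpace ℂ 𝓗] [CompleteSpace 𝓗]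
    (T : 𝓗 →ₗ[ℂ] ((Fin n → ℝ) → ℂ))
    (hTmem : ∀ u : 𝓗, MemL p lam (T u))
    (C : ℝ) (hC : 0 ≤ C)
    (hTbound : ∀ u : 𝓗, LnormSq p lam (T u) ≤ C ^ 2 * ‖u‖ ^ 2) :
    ∃ g : (Fin n → ℝ) → ℝ, Measurable g ∧ (∀ᵐ x ∂volume, 0 ≤ g x) ∧
      (∃ c : ℝ, ∀ a, ENNReal.ofReal (lam a) * pieceNorm q g a ≤ ENNReal.ofReal c) ∧
      ∃ R : 𝓗 →L[ℂ] Lp ℂ 2 (volume : Measure (Fin n → ℝ)),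
        ∀ u : 𝓗, (fun x => (g x : ℂ) * (R u) x) =ᵐ[volume] T u := by
  have hp0 : 0 < p := by linarith
  have hqi : 0 < 1 / q ∧ 1 / q < 1 / 2 := by
    have h1 : 1 / 2 < 1 / p := one_div_lt_one_div_of_lt hp0 hp2
    have h2 : 1 / p < 1 := by rw [div_lt_one hp0]; exact hp1
    constructor <;> linarith
  have hq0 : 0 < q := one_div_pos.1 hqi.1
  have hq2 : 2 ≤ q := by
    have := (one_div_lt_one_div hq0 (by norm_num)).1 hqi.2
    exact this.le
  have hTm : ∀ u, AEStronglyMeasurable (T u) volume := fun u => (hTmem u).1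
  have hb : ∀ u, ∑' a, ENNReal.ofReal (lam a) ^ 2 *
      (∫⁻ x in cellOf ⁻¹' {a}, ‖T u x‖ₑ ^ p) ^ (2 / p) ≤ ENNReal.ofReal (C ^ 2 * ‖u‖ ^ 2) := by
    intro u
    obtain ⟨-, h2, h3⟩ := hTmem u
    refine le_trans (le_of_eq ?_) (ENNReal.ofReal_le_ofReal (hTbound u))
    rw [LnormSq, ENNReal.ofReal_tsum_of_nonneg (fun a => by positivity) h3]
    refine tsum_congr fun a => ?_
    rw [ENNReal.ofReal_mul (by positivity), ENNReal.ofReal_pow (hlam a).le,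
      ENNReal.ofReal_pow ENNReal.toReal_nonneg, ENNReal.ofReal_toReal (h2 a).ne, pieceNorm_eq hp0]
    congr 1
    rw [← ENNReal.rpow_natCast, ← ENNReal.rpow_mul]
    congr 1
    push_cast
    ring
  obtain ⟨g, hgm, hg0, hgq, hgT⟩ := abstract_g (μ := volume) (cellOf_meas (n := n))
    (fun a => by rw [← cube_eq]; exact cube_fin a) hp1 hq2 hq hlam (f := fun u => T u) hTm
    (b := fun u => 4 * C ^ 2 * ‖u‖ ^ 2) (fun u => by positivity)
    (fun S c hc => khin_bound hp1 hp2 _ T hTm C hb S c hc)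
  refine ⟨g, hgm, hg0, ⟨1, fun a => ?_⟩, ?_⟩
  · rw [pieceNorm_eq hq0]
    have e : ∫⁻ x in cellOf ⁻¹' {a}, ‖g x‖ₑ ^ q = ∫⁻ x in cellOf ⁻¹' {a}, phiPow q (g x) := by
      apply lintegral_congr_ae
      filter_upwards [ae_restrict_of_ae hg0] with x hx
      rw [phiPow, Real.enorm_of_nonneg hx]
    rw [e]
    calc _ ≤ ENNReal.ofReal (lam a) * ((ENNReal.ofReal (lam a))⁻¹ ^ q) ^ (1 / q) := by
          gcongr
          exact hgq a
      _ = ENNReal.ofReal (lam a) * (ENNReal.ofReal (lam a))⁻¹ := by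
          rw [← ENNReal.rpow_mul, mul_one_div_cancel hq0.ne', ENNReal.rpow_one]
      _ ≤ ENNReal.ofReal 1 := by
          rw [ENNReal.ofReal_one]; exact ENNReal.mul_inv_le_one _
  · have hmeas : ∀ u, AEStronglyMeasurable (fun x => T u x / (g x : ℂ)) volume := fun u =>
      ((hTm u).aemeasurable.div (Complex.measurable_ofReal.comp hgm).aemeasurable).aestronglyMeasurable
    have hnorm : ∀ u, eLpNorm (fun x => T u x / (g x : ℂ)) 2 volume ≤
        ENNReal.ofReal (4 * C ^ 2 * ‖u‖ ^ 2 + 1) ^ (1 / 2 : ℝ) := by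
      intro u
      rw [eLpNorm_eq_lintegral_rpow_enorm_toReal (by norm_num) (by norm_num)]
      simp only [ENNReal.toReal_ofNat, ENNReal.rpow_two]
      apply ENNReal.rpow_le_rpow _ (by norm_num)
      refine le_trans (lintegral_mono_ae ?_) (hgT u)
      filter_upwards [hg0] with x hx
      rcases hx.eq_or_lt with h | h
      · rw [← h]; simp
      · rw [div_eq_mul_inv, enorm_mul, mul_pow]
        gcongr
        rw [enorm_inv (by exact_mod_cast h.ne'), phiInv, ← ENNReal.inv_pow]
        have he : ‖(g x : ℂ)‖ₑ = ENNReal.ofReal (g x) := by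
          rw [← ofReal_norm, Complex.norm_real, Real.norm_of_nonneg h.le]
        rw [he]
    have hmem : ∀ u, MemLp (fun x => T u x / (g x : ℂ)) 2 volume := fun u =>
      ⟨hmeas u, (hnorm u).trans_lt (ENNReal.rpow_lt_top_of_nonneg (by norm_num) ENNReal.ofReal_ne_top)⟩
    let R₀ : 𝓗 →ₗ[ℂ] Lp ℂ 2 (volume : Measure (Fin n → ℝ)) :=
      { toFun := fun u => (hmem u).toLp _
        map_add' := by
          intro u v
          rw [← MemLp.toLp_add]
          apply MemLp.toLp_congr
          filter_upwards with x
          simp [add_div]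
        map_smul' := by
          intro c u
          rw [RingHom.id_apply, ← MemLp.toLp_const_smul]
          apply MemLp.toLp_congr
          filter_upwards with x
          simp [mul_div_assoc] }
    have hR0 : ∀ u, ‖R₀ u‖ ≤ √(4 * C ^ 2 * ‖u‖ ^ 2 + 1) := by
      intro u
      change ‖(hmem u).toLp _‖ ≤ _
      rw [Lp.norm_toLp]
      apply ENNReal.toReal_le_of_le_ofReal (Real.sqrt_nonneg _)
      rw [Real.sqrt_eq_rpow, ← ENNReal.ofReal_rpow_of_nonneg (by positivity) (by norm_num)]
      exact hnorm u
    have hR1 : ∀ u, ‖R₀ u‖ ≤ √(4 * C ^ 2 + 1) * ‖u‖ := by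
      intro u
      by_cases hu : u = 0
      · simp [hu]
      have hu' : 0 < ‖u‖ := norm_pos_iff.2 hu
      have h1 := hR0 (((‖u‖⁻¹ : ℝ) : ℂ) • u)
      rw [map_smul, norm_smul, norm_smul, Complex.norm_real, Real.norm_eq_abs, abs_of_pos (inv_pos.2 hu'),
        inv_mul_cancel₀ hu'.ne', one_pow, mul_one, inv_mul_le_iff₀ hu'] at h1
      linarith
    refine ⟨R₀.mkContinuous _ hR1, fun u => ?_⟩
    have hae : (R₀ u : (Fin n → ℝ) → ℂ) =ᵐ[volume] fun x => T u x / (g x : ℂ) := (hmem u).coeFn_toLp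
    have hlt : ∀ᵐ x ∂(volume : Measure (Fin n → ℝ)), ‖T u x‖ₑ ^ 2 * phiInv (g x) < ∞ := by
      apply ae_lt_top'
      · exact ((hTm u).enorm.pow_const 2).mul (phiInv_cont.measurable.comp hgm).aemeasurable
      · exact ne_top_of_le_ne_top ENNReal.ofReal_ne_top (hgT u)
    rw [LinearMap.mkContinuous_apply]
    filter_upwards [hae, hlt] with x h1 h2
    rw [h1]
    by_cases h : g x = 0
    · have hT0 : T u x = 0 := by
        by_contra hne
        rw [h, phiInv] at h2
        simp [ENNReal.mul_top, hne] at h2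
      rw [hT0, h]; simp
    · have : (g x : ℂ) ≠ 0 := by exact_mod_cast h
      field_simp

end
end
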